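/- arXiv:1207.5097 — 2 statements merged into one kernel-verified Lean document; each statement's English description precedes it below -/
import Mathlib

section
/- Let n ≥ 1 be an integer, let f satisfy the model assumption and the normalization ∫₀^∞∫_ℝ s^{n-1} f(x²+s²) dx ds = 1, and take the asymmetric L^p loss ρ_{c₁,c₂} with p ≥ 1 and c₂ ≥ c₁ > 0. Let c₀ be the MRE constant and g_{π0} the generalized Bayes function for this loss. Assume all risks below are finite. If δ_g(x,s) = x + c₀s + g(x/s)s belongs to the class C and g(y) ≤ g_{π0}(y) for all y ∈ ℝ, then R((μ,σ), δ_g) ≤ R((μ,σ), δ₀) for every μ ≥ 0 and σ > 0, where δ₀(x,s) = x + c₀s; in particular δ_{π0}(x,s) = x + c₀s + g_{π0}(x/s)s dominates δ₀ on {μ ≥ 0, σ > 0}. -/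
open MeasureTheory Set Filter

/-- Risk of the estimator `δ` at `(μ, σ)` under loss `ρ((d-μ)/σ)` in the
location–scale model `p_{μ,σ}(x,s) = σ^{-(n+1)} s^{n-1} f(((x-μ)²+s²)/σ²)`. -/
noncomputable def risk (n : ℕ) (f ρ : ℝ → ℝ) (δ : ℝ → ℝ → ℝ) (μ σ : ℝ) : ℝ :=
  ∫ s in Ioi (0 : ℝ), ∫ x : ℝ,
    ρ ((δ x s - μ) / σ) * (s ^ (n - 1) / σ ^ (n + 1) * f (((x - μ) ^ 2 + s ^ 2) / σ ^ 2))

/-- The asymmetric `L^p` loss, with weight `α` on the negative and `β` on the positive side. -/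
noncomputable def asymLoss (p α β t : ℝ) : ℝ :=
  if t < 0 then α * |t| ^ p else β * t ^ p

/-- The derivative of `asymLoss p α β`. -/
noncomputable def asymLossDeriv (p α β t : ℝ) : ℝ :=
  if t < 0 then -(α * p * |t| ^ (p - 1)) else β * p * t ^ (p - 1)

section Loss

variable {p α β : ℝ}

lemma asymLossDeriv_of_neg {t : ℝ} (ht : t < 0) :
    asymLossDeriv p α β t = -(α * p * (-t) ^ (p - 1)) := by
  simp [asymLossDeriv, ht, abs_of_neg ht]

lemma asymLossDeriv_of_nonneg {t : ℝ} (ht : 0 ≤ t) :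
    asymLossDeriv p α β t = β * p * t ^ (p - 1) := by
  simp [asymLossDeriv, not_lt.2 ht]

lemma asymLoss_of_neg {t : ℝ} (ht : t < 0) : asymLoss p α β t = α * (-t) ^ p := by
  simp [asymLoss, ht, abs_of_neg ht]

lemma asymLoss_of_nonneg {t : ℝ} (ht : 0 ≤ t) : asymLoss p α β t = β * t ^ p := by
  simp [asymLoss, not_lt.2 ht]

lemma measurable_asymLossDeriv : Measurable (asymLossDeriv p α β) := by
  unfold asymLossDeriv
  exact Measurable.ite measurableSet_Iio (by fun_prop) (by fun_prop)

lemma measurable_asymLoss : Measurable (asymLoss p α β) := by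
  unfold asymLoss
  exact Measurable.ite measurableSet_Iio (by fun_prop) (by fun_prop)

lemma asymLossDeriv_neg (hp : 1 ≤ p) (hα : 0 < α) {t : ℝ} (ht : t < 0) :
    asymLossDeriv p α β t < 0 := by
  rw [asymLossDeriv_of_neg ht]
  have : 0 < (-t) ^ (p - 1) := Real.rpow_pos_of_pos (by linarith) _
  have : 0 < α * p * (-t) ^ (p - 1) := by positivity
  linarith

lemma asymLossDeriv_nonneg (hp : 1 ≤ p) (hβ : 0 ≤ β) {t : ℝ} (ht : 0 ≤ t) :
    0 ≤ asymLossDeriv p α β t := by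
  rw [asymLossDeriv_of_nonneg ht]
  positivity

lemma asymLossDeriv_pos (hp : 1 ≤ p) (hβ : 0 < β) {t : ℝ} (ht : 0 < t) :
    0 < asymLossDeriv p α β t := by
  rw [asymLossDeriv_of_nonneg ht.le]
  positivity

lemma asymLossDeriv_mono (hp : 1 ≤ p) (hα : 0 < α) (hβ : 0 < β) :
    Monotone (asymLossDeriv p α β) := by
  intro a b hab
  rcases lt_or_ge b 0 with hb | hb
  · rw [asymLossDeriv_of_neg hb, asymLossDeriv_of_neg (hab.trans_lt hb)]
    have : (-b) ^ (p - 1) ≤ (-a) ^ (p - 1) :=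
      Real.rpow_le_rpow (by linarith) (by linarith) (by linarith)
    have : α * p * (-b) ^ (p - 1) ≤ α * p * (-a) ^ (p - 1) := by gcongr
    linarith
  rcases lt_or_ge a 0 with ha | ha
  · exact (asymLossDeriv_neg hp hα ha).le.trans (asymLossDeriv_nonneg hp hβ.le hb)
  · rw [asymLossDeriv_of_nonneg ha, asymLossDeriv_of_nonneg hb]
    have : a ^ (p - 1) ≤ b ^ (p - 1) := Real.rpow_le_rpow ha hab (by linarith)
    gcongr

lemma asymLossDeriv_mul {r : ℝ} (hr : 0 < r) (t : ℝ) :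
    asymLossDeriv p α β (r * t) = r ^ (p - 1) * asymLossDeriv p α β t := by
  rcases lt_or_ge t 0 with ht | ht
  · rw [asymLossDeriv_of_neg ht, asymLossDeriv_of_neg (mul_neg_of_pos_of_neg hr ht),
      ← mul_neg r t, Real.mul_rpow hr.le (by linarith)]
    ring
  · rw [asymLossDeriv_of_nonneg ht, asymLossDeriv_of_nonneg (by positivity),
      Real.mul_rpow hr.le ht]
    ring

lemma asymLoss_mul {r : ℝ} (hr : 0 < r) (t : ℝ) :
    asymLoss p α β (r * t) = r ^ p * asymLoss p α β t := by
  rcases lt_or_ge t 0 with ht | ht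
  · rw [asymLoss_of_neg ht, asymLoss_of_neg (mul_neg_of_pos_of_neg hr ht),
      ← mul_neg r t, Real.mul_rpow hr.le (by linarith)]
    ring
  · rw [asymLoss_of_nonneg ht, asymLoss_of_nonneg (by positivity), Real.mul_rpow hr.le ht]
    ring

lemma asymLoss_pos (hα : 0 < α) (hβ : 0 < β) {t : ℝ} (ht : t ≠ 0) : 0 < asymLoss p α β t := by
  rcases lt_or_gt_of_ne ht with ht | ht
  · rw [asymLoss_of_neg ht]
    exact mul_pos hα (Real.rpow_pos_of_pos (by linarith) _)
  · rw [asymLoss_of_nonneg ht.le]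
    positivity

lemma abs_asymLossDeriv (hp : 1 ≤ p) (hα : 0 < α) (hβ : 0 < β) (t : ℝ) :
    |asymLossDeriv p α β t| = asymLossDeriv p (-α) β t := by
  rcases lt_or_ge t 0 with ht | ht
  · rw [abs_of_neg (asymLossDeriv_neg hp hα ht), asymLossDeriv_of_neg ht, asymLossDeriv_of_neg ht]
    ring
  · rw [abs_of_nonneg (asymLossDeriv_nonneg hp hβ.le ht), asymLossDeriv_of_nonneg ht,
      asymLossDeriv_of_nonneg ht]

lemma abs_asymLossDeriv_le (t : ℝ) :
    |asymLossDeriv p α β t| ≤ (|α| + |β|) * |p| * |t| ^ (p - 1) := by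
  have h2 : 0 ≤ |t| ^ (p - 1) := by positivity
  have h3 : 0 ≤ |p| * |t| ^ (p - 1) := by positivity
  have h4 := abs_nonneg α
  have h5 := abs_nonneg β
  rcases lt_or_ge t 0 with ht | ht
  · rw [asymLossDeriv_of_neg ht, ← abs_of_neg ht]
    simp only [abs_neg, abs_mul, abs_of_nonneg h2]
    nlinarith
  · rw [asymLossDeriv_of_nonneg ht]
    nth_rewrite 1 [← abs_of_nonneg ht]
    simp only [abs_mul, abs_of_nonneg h2]
    nlinarith

lemma continuous_asymLoss (hp : 1 ≤ p) : Continuous (asymLoss p α β) := by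
  have hp0 : 0 < p := by linarith
  unfold asymLoss
  refine Continuous.if ?_ ?_ ?_
  · intro a ha
    have : a = 0 := by
      change a ∈ frontier (Iio (0 : ℝ)) at ha
      simpa [frontier_Iio] using ha
    simp [this, Real.zero_rpow hp0.ne']
  · exact continuous_const.mul (continuous_abs.rpow_const fun _ => Or.inr hp0.le)
  · exact continuous_const.mul (continuous_id.rpow_const fun _ => Or.inr hp0.le)

lemma hasDerivAt_asymLoss {t : ℝ} (ht : t ≠ 0) :
    HasDerivAt (asymLoss p α β) (asymLossDeriv p α β t) t := by
  rcases lt_or_gt_of_ne ht with ht | ht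
  · rw [asymLossDeriv_of_neg ht]
    have h : HasDerivAt (fun t : ℝ => α * (-t) ^ p) (α * (-1 * p * (-t) ^ (p - 1))) t :=
      ((hasDerivAt_neg t).rpow_const (Or.inl (by linarith))).const_mul α
    refine (h.congr_deriv (by ring)).congr_of_eventuallyEq ?_
    filter_upwards [Iio_mem_nhds ht] with x hx using asymLoss_of_neg hx
  · rw [asymLossDeriv_of_nonneg ht.le]
    have h : HasDerivAt (fun t : ℝ => β * t ^ p) (β * (1 * p * t ^ (p - 1))) t :=
      ((hasDerivAt_id t).rpow_const (Or.inl (by simpa using ht.ne'))).const_mul β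
    refine (h.congr_deriv (by ring)).congr_of_eventuallyEq ?_
    filter_upwards [Ioi_mem_nhds ht] with x hx using asymLoss_of_nonneg (le_of_lt hx)

lemma intervalIntegrable_asymLossDeriv (hp : 1 ≤ p) (a b : ℝ) :
    IntervalIntegrable (asymLossDeriv p α β) volume a b := by
  have h1 : Continuous fun t : ℝ => (|α| + |β|) * |p| * |t| ^ (p - 1) :=
    continuous_const.mul (continuous_abs.rpow_const fun _ => Or.inr (by linarith))
  refine (h1.intervalIntegrable a b).mono_fun measurable_asymLossDeriv.aestronglyMeasurable ?_
  filter_upwards with t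
  exact (abs_asymLossDeriv_le t).trans (le_abs_self _)

/-- Fundamental theorem of calculus along the line `z ↦ a + z s`. -/
lemma integral_asymLossDeriv_line (hp : 1 ≤ p) (a : ℝ) {s G : ℝ} (hs : 0 < s) (hG : 0 ≤ G) :
    IntegrableOn (fun z => asymLossDeriv p α β (a + z * s) * s) (Ioo 0 G) ∧
    ∫ z in Ioo 0 G, asymLossDeriv p α β (a + z * s) * s =
      asymLoss p α β (a + G * s) - asymLoss p α β a := by
  have hint : IntervalIntegrable (asymLossDeriv p α β) volume (a + s * 0) (a + s * G) :=
    intervalIntegrable_asymLossDeriv hp _ _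
  have key : ∫ x in (a + s * 0)..(a + s * G), asymLossDeriv p α β x =
      asymLoss p α β (a + s * G) - asymLoss p α β (a + s * 0) :=
    integral_eq_of_hasDerivAt_off_countable _ _ (countable_singleton (0 : ℝ))
      (continuous_asymLoss hp).continuousOn
      (fun x hx => hasDerivAt_asymLoss (by simpa using hx.2)) hint
  constructor
  · have h1 : Continuous fun z : ℝ => (|α| + |β|) * |p| * |a + z * s| ^ (p - 1) * s :=
      (continuous_const.mul ((by fun_prop : Continuous fun z : ℝ => |a + z * s|).rpow_const
        fun _ => Or.inr (by linarith))).mul continuous_const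
    refine Integrable.mono' ((h1.integrableOn_Icc (a := 0) (b := G)).mono_set Ioo_subset_Icc_self)
      ((measurable_asymLossDeriv.comp (by fun_prop)).mul_const s).aestronglyMeasurable ?_
    filter_upwards with z
    rw [Real.norm_eq_abs, abs_mul, abs_of_pos hs]
    exact mul_le_mul_of_nonneg_right (abs_asymLossDeriv_le _) hs.le
  · rw [integral_Ioc_eq_integral_Ioo.symm, ← intervalIntegral.integral_of_le hG]
    have := intervalIntegral.smul_integral_comp_add_mul (a := 0) (b := G)
      (asymLossDeriv p α β) s a
    rw [key] at this
    simp only [mul_zero, add_zero, smul_eq_mul] at this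
    rw [mul_comm G s, ← this, intervalIntegral.integral_mul_const]
    simp only [mul_comm _ s]

end Loss

section Crossing

/-- A function on `(0, m]` that is nonnegative to the left of each point of positivity is
nonnegative up to some point and nonpositive from there on. -/
lemma exists_sign_change {m : ℝ} (hm : 0 < m) {ψ : ℝ → ℝ}
    (hψ : ∀ w w', 0 < w → w < w' → w' ≤ m → 0 < ψ w' → 0 ≤ ψ w) :
    ∃ w₀, 0 ≤ w₀ ∧ w₀ ≤ m ∧ (∀ w, 0 < w → w < w₀ → 0 ≤ ψ w) ∧
      (∀ w, w₀ < w → w ≤ m → ψ w ≤ 0) := by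
  set S : Set ℝ := {w | w = 0 ∨ (0 < w ∧ w ≤ m ∧ 0 < ψ w)} with hS
  have h0 : (0 : ℝ) ∈ S := Or.inl rfl
  have hbdd : ∀ w ∈ S, w ≤ m := by
    rintro w (rfl | h)
    · exact hm.le
    · exact h.2.1
  have hB : BddAbove S := ⟨m, hbdd⟩
  refine ⟨sSup S, le_csSup hB h0, csSup_le ⟨0, h0⟩ hbdd, ?_, ?_⟩
  · intro w hw hlt
    obtain ⟨w', hw', hlt'⟩ := exists_lt_of_lt_csSup ⟨0, h0⟩ hlt
    rcases hw' with rfl | h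
    · linarith
    · exact hψ w w' hw hlt' h.2.1 h.2.2
  · intro w hw hwm
    by_contra! hPw
    have : w ∈ S := Or.inr ⟨(le_csSup hB h0).trans_lt hw, hwm, hPw⟩
    exact absurd (le_csSup hB this) (not_le.2 hw)

/-- The monotone likelihood ratio property for the scale family generated by `f`. -/
lemma antitoneOn_scale_ratio {f fd : ℝ → ℝ} (hf_pos : ∀ t > (0 : ℝ), 0 < f t)
    (hf_deriv : ∀ t > (0 : ℝ), HasDerivAt f (fd t) t)
    (hf_mlr : AntitoneOn (fun t => t * fd t / f t) (Ioi 0)) {a b : ℝ} (ha : 0 < a) (hab : a ≤ b) :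
    AntitoneOn (fun q => f (b * q) / f (a * q)) (Ioi 0) := by
  have hb : 0 < b := ha.trans_le hab
  have hd : ∀ q > (0 : ℝ), HasDerivAt (fun q => f (b * q) / f (a * q))
      ((fd (b * q) * b * f (a * q) - f (b * q) * (fd (a * q) * a)) / f (a * q) ^ 2) q := by
    intro q hq
    have h : ∀ c > (0 : ℝ), HasDerivAt (fun q => f (c * q)) (fd (c * q) * c) q := fun c hc =>
      (hf_deriv (c * q) (mul_pos hc hq)).comp q (by simpa using (hasDerivAt_id q).const_mul c)
    exact (h b hb).div (h a ha) (hf_pos _ (mul_pos ha hq)).ne'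
  refine antitoneOn_of_deriv_nonpos (convex_Ioi 0)
    (fun q hq => (hd q hq).continuousAt.continuousWithinAt) ?_ ?_
  · intro q hq
    rw [interior_Ioi] at hq
    exact (hd q hq).differentiableAt.differentiableWithinAt
  · intro q hq
    rw [interior_Ioi] at hq
    have hq : 0 < q := hq
    rw [(hd q hq).deriv]
    refine div_nonpos_of_nonpos_of_nonneg ?_ (sq_nonneg _)
    have hA := hf_pos _ (mul_pos ha hq)
    have hB := hf_pos _ (mul_pos hb hq)
    have h := hf_mlr (mem_Ioi.2 (mul_pos ha hq)) (mem_Ioi.2 (mul_pos hb hq))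
      (mul_le_mul_of_nonneg_right hab hq.le)
    simp only at h
    rw [div_le_div_iff₀ hB hA] at h
    nlinarith

variable {p α β : ℝ}

/-- The weight `ρ'(w K - 1) w ^ n` folded about `w = m`. -/
lemma folded_weight_cut (n : ℕ) (hp : 1 ≤ p) (hα : 0 < α) (hαβ : α ≤ β) {K m : ℝ} (hK : 0 < K)
    (w w' : ℝ) (hw : 0 < w) (hww' : w < w') (hw'm : w' ≤ m)
    (h : 0 < asymLossDeriv p α β (w' * K - 1) * w' ^ n +
      asymLossDeriv p α β ((2 * m - w') * K - 1) * (2 * m - w') ^ n) :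
    0 ≤ asymLossDeriv p α β (w * K - 1) * w ^ n +
      asymLossDeriv p α β ((2 * m - w) * K - 1) * (2 * m - w) ^ n := by
  have hβ : 0 < β := hα.trans_le hαβ
  have hw2 : w ≤ 2 * m - w := by linarith
  have hpow : w ^ n ≤ (2 * m - w) ^ n := pow_le_pow_left₀ hw.le hw2 n
  have hwn : 0 < w ^ n := pow_pos hw n
  rcases le_or_gt 0 (w * K - 1) with hA | hA
  · have hB : 0 ≤ (2 * m - w) * K - 1 := by nlinarith
    have h1 := asymLossDeriv_nonneg (α := α) hp hβ.le hA
    have h2 := asymLossDeriv_nonneg (α := α) hp hβ.le hB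
    have := hwn.le.trans hpow
    positivity
  rcases le_or_gt 1 (m * K) with hmK | hmK
  · have hB : -(w * K - 1) ≤ (2 * m - w) * K - 1 := by nlinarith
    rw [asymLossDeriv_of_neg hA, asymLossDeriv_of_nonneg (by linarith)]
    have h1 : (-(w * K - 1)) ^ (p - 1) ≤ ((2 * m - w) * K - 1) ^ (p - 1) :=
      Real.rpow_le_rpow (by linarith) hB (by linarith)
    have h0 : 0 ≤ (-(w * K - 1)) ^ (p - 1) := Real.rpow_nonneg (by linarith) _
    have h2 := h0.trans h1
    have : α * p * (-(w * K - 1)) ^ (p - 1) * w ^ n ≤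
        β * p * ((2 * m - w) * K - 1) ^ (p - 1) * (2 * m - w) ^ n := by gcongr
    linarith
  · have hA' : w' * K - 1 < 0 := by nlinarith
    have hw'0 : 0 < w' := hw.trans hww'
    have hB' : 0 ≤ (2 * m - w') * K - 1 := by
      by_contra hneg
      push Not at hneg
      have h1 := asymLossDeriv_neg (β := β) hp hα hA'
      have h2 := asymLossDeriv_neg (β := β) hp hα hneg
      have h3 : 0 < w' ^ n := pow_pos hw'0 n
      have h4 : 0 < (2 * m - w') ^ n := pow_pos (by linarith) n
      nlinarith
    have hB : 0 ≤ (2 * m - w) * K - 1 := by nlinarith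
    rw [asymLossDeriv_of_neg hA', asymLossDeriv_of_nonneg hB'] at h
    rw [asymLossDeriv_of_neg hA, asymLossDeriv_of_nonneg hB]
    set a := -(w * K - 1) with ha
    set a' := -(w' * K - 1) with ha'
    set b := (2 * m - w) * K - 1 with hb
    set b' := (2 * m - w') * K - 1 with hb'
    have hapos : 0 < a := by linarith
    have ha'pos : 0 < a' := by linarith
    have hcross : a * b' ≤ b * a' := by
      have : b * a' - a * b' = (w' - w) * (K * (2 - 2 * (m * K))) := by
        rw [ha, ha', hb, hb']; ring
      have : 0 ≤ (w' - w) * (K * (2 - 2 * (m * K))) :=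
        mul_nonneg (by linarith) (mul_nonneg hK.le (by linarith))
      linarith
    have hc := Real.rpow_le_rpow (mul_nonneg hapos.le hB') hcross (z := p - 1) (by linarith)
    rw [Real.mul_rpow hapos.le hB', Real.mul_rpow hB ha'pos.le] at hc
    have hap := Real.rpow_pos_of_pos hapos (p - 1)
    have ha'p := Real.rpow_pos_of_pos ha'pos (p - 1)
    have hbp := Real.rpow_nonneg hB (p - 1)
    have hb'p := Real.rpow_nonneg hB' (p - 1)
    set A := a ^ (p - 1)
    set A' := a' ^ (p - 1)
    set B := b ^ (p - 1)
    set B' := b' ^ (p - 1)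
    have h1 : α * p * A' * w' ^ n ≤ β * p * B' * (2 * m - w') ^ n := by linarith
    have hpw : w ^ n ≤ w' ^ n := pow_le_pow_left₀ hw.le hww'.le n
    have hpm : (2 * m - w') ^ n ≤ (2 * m - w) ^ n :=
      pow_le_pow_left₀ (by linarith) (by linarith) n
    have hm'n : 0 ≤ (2 * m - w') ^ n := pow_nonneg (by linarith) n
    have h2 : α * p * A * w ^ n * A' ≤ β * p * B * (2 * m - w) ^ n * A' := calc
      α * p * A * w ^ n * A' ≤ α * p * A * w' ^ n * A' := by gcongr
      _ = A * (α * p * A' * w' ^ n) := by ring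
      _ ≤ A * (β * p * B' * (2 * m - w') ^ n) := by gcongr
      _ = β * p * (A * B') * (2 * m - w') ^ n := by ring
      _ ≤ β * p * (B * A') * (2 * m - w) ^ n := by gcongr
      _ = _ := by ring
    have := le_of_mul_le_mul_right h2 ha'p
    linarith

/-- Sign changes of `τ ↦ ∫ ρ'(w K - 1) w ^ n f(τ² ((w y - 1)² + w²)) dw` are from `+` to `-`. -/
lemma integral_scaled_nonpos (n : ℕ) (hp : 1 ≤ p) (hα : 0 < α) (hαβ : α ≤ β) {f fd : ℝ → ℝ}
    (hf_pos : ∀ t > (0 : ℝ), 0 < f t)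
    (hf_deriv : ∀ t > (0 : ℝ), HasDerivAt f (fd t) t)
    (hf_mlr : AntitoneOn (fun t => t * fd t / f t) (Ioi 0))
    (y K : ℝ) {a b : ℝ} (ha : 0 < a) (hab : a ≤ b)
    (hia : IntegrableOn (fun w => asymLossDeriv p α β (w * K - 1) * w ^ n *
      f (a * ((w * y - 1) ^ 2 + w ^ 2))) (Ioi 0))
    (hib : IntegrableOn (fun w => asymLossDeriv p α β (w * K - 1) * w ^ n *
      f (b * ((w * y - 1) ^ 2 + w ^ 2))) (Ioi 0))
    (hle : ∫ w in Ioi (0 : ℝ), asymLossDeriv p α β (w * K - 1) * w ^ n *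
      f (a * ((w * y - 1) ^ 2 + w ^ 2)) ≤ 0) :
    ∫ w in Ioi (0 : ℝ), asymLossDeriv p α β (w * K - 1) * w ^ n *
      f (b * ((w * y - 1) ^ 2 + w ^ 2)) ≤ 0 := by
  have hβ : 0 < β := hα.trans_le hαβ
  have hb : 0 < b := ha.trans_le hab
  set h : ℝ → ℝ := fun w => asymLossDeriv p α β (w * K - 1) * w ^ n with hh
  set q : ℝ → ℝ := fun w => (w * y - 1) ^ 2 + w ^ 2 with hq
  have hqpos : ∀ w, 0 < q w := by
    intro w
    rcases eq_or_ne w 0 with rfl | hw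
    · simp [hq]
    · have : 0 < w ^ 2 := by positivity
      have := sq_nonneg (w * y - 1)
      simp only [hq]; linarith
  rcases le_or_gt K 0 with hK | hK
  · refine setIntegral_nonpos measurableSet_Ioi fun w hw => ?_
    have hw : 0 < w := hw
    have h1 := asymLossDeriv_neg (β := β) hp hα (t := w * K - 1) (by nlinarith)
    have h2 := hf_pos _ (mul_pos hb (hqpos w))
    have h3 : 0 < w ^ n := by positivity
    have : asymLossDeriv p α β (w * K - 1) * w ^ n < 0 := mul_neg_of_neg_of_pos h1 h3
    exact (mul_neg_of_neg_of_pos this h2).le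
  set R : ℝ → ℝ := fun t => f (b * t) / f (a * t) with hR
  have hRanti : AntitoneOn R (Ioi 0) := antitoneOn_scale_ratio hf_pos hf_deriv hf_mlr ha hab
  have hfR : ∀ w, f (b * q w) = R (q w) * f (a * q w) := fun w => by
    rw [hR]; exact (div_mul_cancel₀ _ (hf_pos _ (mul_pos ha (hqpos w))).ne').symm
  have hRpos : ∀ w, 0 < R (q w) := fun w =>
    div_pos (hf_pos _ (mul_pos hb (hqpos w))) (hf_pos _ (mul_pos ha (hqpos w)))
  have hmono : ∀ w w', q w ≤ q w' → R (q w') ≤ R (q w) := fun w w' hle =>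
    hRanti (mem_Ioi.2 (hqpos w)) (mem_Ioi.2 (hqpos w')) hle
  have hneg : ∀ w, 0 < w → w * K < 1 → h w ≤ 0 := fun w hw hwK =>
    mul_nonpos_of_nonpos_of_nonneg (asymLossDeriv_neg hp hα (by linarith)).le (by positivity)
  have hnonneg : ∀ w, 0 < w → 1 ≤ w * K → 0 ≤ h w := fun w hw hwK =>
    mul_nonneg (asymLossDeriv_nonneg hp hβ.le (by linarith)) (by positivity)
  suffices H : ∃ w₀, ∫ w in Ioi (0 : ℝ), h w * (R (q w) - R (q w₀)) * f (a * q w) ≤ 0 by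
    obtain ⟨w₀, hw₀⟩ := H
    have e : (fun w => h w * (R (q w) - R (q w₀)) * f (a * q w)) =
        fun w => h w * f (b * q w) - R (q w₀) * (h w * f (a * q w)) := by
      funext w; rw [hfR]; ring
    rw [e, integral_sub hib (hia.const_mul _), integral_const_mul] at hw₀
    have := mul_nonpos_of_nonneg_of_nonpos (hRpos w₀).le hle
    linarith
  rcases le_or_gt (2 * y * K) (1 + y ^ 2) with hcase | hcase
  · refine ⟨1 / K, setIntegral_nonpos measurableSet_Ioi fun w hw => ?_⟩
    have hw : 0 < w := hw
    have hfa := (hf_pos _ (mul_pos ha (hqpos w))).le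
    refine mul_nonpos_of_nonpos_of_nonneg ?_ hfa
    have hKK : 0 ≤ (1 + y ^ 2) * (1 / K + w) - 2 * y := by
      have : 2 * y ≤ (1 + y ^ 2) / K := by rw [le_div_iff₀ hK]; exact hcase
      have h2 : 0 ≤ (1 + y ^ 2) * w := by positivity
      have : (1 + y ^ 2) * (1 / K) = (1 + y ^ 2) / K := by ring
      rw [mul_add]; linarith
    have hdiff : q (1 / K) - q w = (1 / K - w) * ((1 + y ^ 2) * (1 / K + w) - 2 * y) := by
      simp only [hq]; ring
    rcases lt_or_ge (w * K) 1 with hwK | hwK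
    · have h1 : w ≤ 1 / K := by rw [le_div_iff₀ hK]; exact hwK.le
      refine mul_nonpos_of_nonpos_of_nonneg (hneg w hw hwK) (sub_nonneg.2 (hmono _ _ ?_))
      have := mul_nonneg (sub_nonneg.2 h1) hKK
      linarith
    · have h1 : 1 / K ≤ w := by rw [div_le_iff₀ hK]; exact hwK
      refine mul_nonpos_of_nonneg_of_nonpos (hnonneg w hw hwK) (sub_nonpos.2 (hmono _ _ ?_))
      have := mul_nonneg (sub_nonneg.2 h1) hKK
      linarith
  · have hy : 0 < y := by
      by_contra hy
      push Not at hy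
      have := mul_nonneg (neg_nonneg.2 hy) hK.le
      nlinarith [sq_nonneg y]
    set m : ℝ := y / (1 + y ^ 2) with hm_def
    have hy2 : 0 < 1 + y ^ 2 := by positivity
    have hm : 0 < m := by positivity
    have hmy : m * (1 + y ^ 2) = y := div_mul_cancel₀ _ hy2.ne'
    have hmK : 1 < 2 * m * K := by
      have : 1 < 2 * y * K / (1 + y ^ 2) := by rw [lt_div_iff₀ hy2]; linarith
      calc (1 : ℝ) < _ := this
        _ = _ := by rw [hm_def]; ring
    have hqm : ∀ w, q w = (1 + y ^ 2) * (w - m) ^ 2 + q m := by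
      intro w
      have : q w - ((1 + y ^ 2) * (w - m) ^ 2 + q m) = 2 * (w - m) * (m * (1 + y ^ 2) - y) := by
        simp only [hq]; ring
      rw [hmy] at this; linarith
    have hqle : ∀ w w', (w - m) ^ 2 ≤ (w' - m) ^ 2 → q w ≤ q w' := by
      intro w w' hle
      rw [hqm w, hqm w']
      gcongr
    have hqsymm : ∀ w, q (2 * m - w) = q w := by
      intro w
      rw [hqm, hqm w]; ring
    obtain ⟨w₀, hw₀, hw₀m, hlow, hhigh⟩ := exists_sign_change hm
      (ψ := fun w => h w + h (2 * m - w)) (folded_weight_cut n hp hα hαβ hK)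
    refine ⟨w₀, ?_⟩
    set Φ : ℝ → ℝ := fun w => h w * (R (q w) - R (q w₀)) * f (a * q w) with hΦ
    have hΦi : IntegrableOn Φ (Ioi 0) := by
      have e : Φ = fun w => h w * f (b * q w) - R (q w₀) * (h w * f (a * q w)) := by
        funext w; rw [hfR]; ring
      rw [e]
      exact hib.sub (hia.const_mul _)
    have h2m : 0 ≤ 2 * m := by linarith
    have hsplit : ∫ w in Ioi (0 : ℝ), Φ w = (∫ w in (0 : ℝ)..(2 * m), Φ w) +
        ∫ w in Ioi (2 * m), Φ w := by
      rw [intervalIntegral.integral_of_le h2m, ← setIntegral_union Ioc_disjoint_Ioi_same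
        measurableSet_Ioi (hΦi.mono_set Ioc_subset_Ioi_self)
        (hΦi.mono_set (Ioi_subset_Ioi h2m)), Ioc_union_Ioi_eq_Ioi h2m]
    have hII : IntervalIntegrable Φ volume 0 (2 * m) :=
      (intervalIntegrable_iff_integrableOn_Ioc_of_le h2m).2 (hΦi.mono_set Ioc_subset_Ioi_self)
    have hII' : IntervalIntegrable (fun w => Φ (2 * m - w)) volume 0 (2 * m) := by
      simpa using (hII.comp_sub_left (2 * m)).symm
    have hfold : ∀ w, 0 < w → w ≤ m → Φ w + Φ (2 * m - w) ≤ 0 := by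
      intro w hw hwm
      have e : Φ w + Φ (2 * m - w) =
          (h w + h (2 * m - w)) * (R (q w) - R (q w₀)) * f (a * q w) := by
        simp only [hΦ, hqsymm]; ring
      rw [e]
      refine mul_nonpos_of_nonpos_of_nonneg ?_ (hf_pos _ (mul_pos ha (hqpos w))).le
      rcases lt_trichotomy w w₀ with hlt | rfl | hgt
      · refine mul_nonpos_of_nonneg_of_nonpos (hlow w hw hlt) (sub_nonpos.2 (hmono _ _ ?_))
        exact hqle _ _ (by nlinarith)
      · simp
      · refine mul_nonpos_of_nonpos_of_nonneg (hhigh w hgt hwm)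
          (sub_nonneg.2 (hmono _ _ ?_))
        exact hqle _ _ (by nlinarith)
    have hmid : ∫ w in (0 : ℝ)..(2 * m), Φ w ≤ 0 := by
      have e : ∫ w in (0 : ℝ)..(2 * m), Φ (2 * m - w) = ∫ w in (0 : ℝ)..(2 * m), Φ w := by
        simp [intervalIntegral.integral_comp_sub_left]
      have hs : ∫ w in (0 : ℝ)..(2 * m), (Φ w + Φ (2 * m - w)) ≤ 0 := by
        rw [intervalIntegral.integral_of_le h2m, integral_Ioc_eq_integral_Ioo]
        refine setIntegral_nonpos measurableSet_Ioo fun w hw => ?_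
        rcases le_total w m with hwm | hwm
        · exact hfold w hw.1 hwm
        · have := hfold (2 * m - w) (by linarith [hw.2]) (by linarith)
          rw [sub_sub_cancel] at this
          linarith
      rw [intervalIntegral.integral_add hII hII', e] at hs
      linarith
    have htail : ∫ w in Ioi (2 * m), Φ w ≤ 0 := by
      refine setIntegral_nonpos measurableSet_Ioi fun w hw => ?_
      have hw : 2 * m < w := hw
      refine mul_nonpos_of_nonpos_of_nonneg ?_ (hf_pos _ (mul_pos ha (hqpos w))).le
      refine mul_nonpos_of_nonneg_of_nonpos (hnonneg w (by linarith) (by nlinarith))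
        (sub_nonpos.2 (hmono _ _ (hqle _ _ ?_)))
      nlinarith
    linarith

end Crossing

/-- Lebesgue measure on the half plane of pairs `(v, u)` with `v > 0`. -/
noncomputable def halfPlane : Measure (ℝ × ℝ) := (volume.restrict (Ioi (0 : ℝ))).prod volume

instance : SFinite halfPlane := by
  unfold halfPlane
  infer_instance

section Moment

variable {p α β : ℝ} {f : ℝ → ℝ}

lemma halfPlane_eq : halfPlane = volume.restrict (Ioi (0 : ℝ) ×ˢ (univ : Set ℝ)) := by
  rw [halfPlane, Measure.volume_eq_prod, ← Measure.prod_restrict, Measure.restrict_univ]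

lemma ae_halfPlane_pos : ∀ᵐ q ∂halfPlane, 0 < q.1 := by
  rw [halfPlane_eq]
  filter_upwards [ae_restrict_mem (measurableSet_Ioi.prod MeasurableSet.univ)] with q hq
  exact hq.1

lemma integrableOn_prod_swap_iff (F : ℝ × ℝ → ℝ) :
    IntegrableOn F (univ ×ˢ Ioi 0) ↔ Integrable (fun q : ℝ × ℝ => F (q.2, q.1)) halfPlane := by
  rw [IntegrableOn, Measure.volume_eq_prod, ← Measure.prod_restrict, Measure.restrict_univ,
    halfPlane, ← integrable_swap_iff]
  rfl

/-- Finiteness of the risk of `x + c₀ s` at `(0, 1)` is finiteness of a radial moment. -/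
lemma integrableOn_radial (n : ℕ) (hn : 1 ≤ n) (hα : 0 < α) (hβ : 0 < β)
    (hfm : Measurable f) (c₀ : ℝ)
    (h : Integrable (fun q : ℝ × ℝ => asymLoss p α β (q.2 + c₀ * q.1) *
      (q.1 ^ (n - 1) * f (q.2 ^ 2 + q.1 ^ 2))) halfPlane) :
    IntegrableOn (fun r : ℝ => r ^ (p + n) * f (r ^ 2)) (Ioi 0) := by
  set H : ℝ × ℝ → ℝ := fun q => asymLoss p α β (q.1 + c₀ * q.2) *
      (q.2 ^ (n - 1) * f (q.1 ^ 2 + q.2 ^ 2)) with hH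
  have hHm : Measurable H := by
    have h1 : Measurable fun q : ℝ × ℝ => asymLoss p α β (q.1 + c₀ * q.2) :=
      measurable_asymLoss.comp (by fun_prop)
    fun_prop
  have hHi : IntegrableOn H (univ ×ˢ Ioi 0) := (integrableOn_prod_swap_iff H).2 h
  have hS : MeasurableSet ((univ : Set ℝ) ×ˢ Ioi (0 : ℝ)) :=
    MeasurableSet.univ.prod measurableSet_Ioi
  have hfin : ∫⁻ q, ((univ : Set ℝ) ×ˢ Ioi (0 : ℝ)).indicator (fun q => ‖H q‖ₑ) q < ⊤ := by
    rw [lintegral_indicator hS]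
    exact hHi.2
  rw [← lintegral_comp_polarCoord_symm] at hfin
  obtain ⟨l, u, hlu, hl, hu, hne⟩ : ∃ l u : ℝ, l < u ∧ 0 ≤ l ∧ u ≤ Real.pi ∧
      ∀ φ ∈ Ioo l u, Real.cos φ + c₀ * Real.sin φ ≠ 0 := by
    rcases le_total 0 c₀ with hc | hc
    · refine ⟨0, Real.pi / 2, by positivity, le_rfl, by linarith [Real.pi_pos], ?_⟩
      intro φ hφ
      have h1 := Real.cos_pos_of_mem_Ioo (x := φ) ⟨by linarith [hφ.1, Real.pi_pos], hφ.2⟩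
      have h2 := Real.sin_pos_of_mem_Ioo (x := φ) ⟨hφ.1, by linarith [hφ.2, Real.pi_pos]⟩
      positivity
    · refine ⟨Real.pi / 2, Real.pi, by linarith [Real.pi_pos], by positivity, le_rfl, ?_⟩
      intro φ hφ
      have h1 := Real.cos_neg_of_pi_div_two_lt_of_lt hφ.1 (by linarith [hφ.2, Real.pi_pos])
      have h2 := Real.sin_pos_of_mem_Ioo (x := φ) ⟨by linarith [hφ.1, Real.pi_pos], hφ.2⟩
      have := mul_nonneg (neg_nonneg.2 hc) h2.le
      intro h0
      linarith
  have hsub : Ioi (0 : ℝ) ×ˢ Ioo l u ⊆ polarCoord.target := by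
    rintro ⟨r, φ⟩ ⟨hr, hφ⟩
    exact ⟨hr, by linarith [hφ.1, Real.pi_pos], by linarith [hφ.2]⟩
  have hfin2 := (lintegral_mono_set (μ := volume) hsub).trans_lt hfin
  have hpm : Measurable fun q : ℝ × ℝ => ENNReal.ofReal q.1 •
      ((univ : Set ℝ) ×ˢ Ioi (0 : ℝ)).indicator (fun q => ‖H q‖ₑ) (polarCoord.symm q) := by
    have h1 : Measurable fun q : ℝ × ℝ => ((univ : Set ℝ) ×ˢ Ioi (0 : ℝ)).indicator
      (fun q => ‖H q‖ₑ) (polarCoord.symm q) :=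
      (hHm.enorm.indicator hS).comp continuous_polarCoord_symm.measurable
    simp only [smul_eq_mul]
    exact (ENNReal.measurable_ofReal.comp measurable_fst).mul h1
  rw [Measure.volume_eq_prod, ← Measure.prod_restrict, lintegral_prod_symm _ hpm.aemeasurable]
    at hfin2
  have hae := ae_lt_top hpm.lintegral_prod_left' hfin2.ne
  have : NeBot (ae (volume.restrict (Ioo l u))) := by
    rw [ae_neBot]
    simp [Measure.restrict_eq_zero, hlu]
  obtain ⟨φ, hφ, hφlu⟩ := (hae.and (ae_restrict_mem measurableSet_Ioo)).exists
  have hsin : 0 < Real.sin φ :=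
    Real.sin_pos_of_mem_Ioo ⟨by linarith [hφlu.1], by linarith [hφlu.2]⟩
  set A : ℝ := asymLoss p α β (Real.cos φ + c₀ * Real.sin φ) * Real.sin φ ^ (n - 1) with hA
  have hApos : 0 < A := mul_pos (asymLoss_pos hα hβ (hne φ hφlu)) (by positivity)
  have hAint : IntegrableOn (fun r : ℝ => A * (r ^ (p + n) * f (r ^ 2))) (Ioi 0) := by
    refine ⟨by fun_prop, ?_⟩
    refine lt_of_eq_of_lt ?_ hφ
    refine setLIntegral_congr_fun measurableSet_Ioi fun r hr => ?_
    have hr : 0 < r := hr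
    have hmem : polarCoord.symm (r, φ) ∈ (univ : Set ℝ) ×ˢ Ioi (0 : ℝ) := by
      simp [polarCoord_symm_apply, hr, hsin]
    simp only [indicator_of_mem hmem, smul_eq_mul]
    rw [← Real.enorm_of_nonneg hr.le, ← enorm_mul]
    congr 1
    simp only [hH, polarCoord_symm_apply]
    have e1 : r * Real.cos φ + c₀ * (r * Real.sin φ) =
        r * (Real.cos φ + c₀ * Real.sin φ) := by ring
    have e2 : (r * Real.cos φ) ^ 2 + (r * Real.sin φ) ^ 2 = r ^ 2 := by
      have := Real.sin_sq_add_cos_sq φ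
      linear_combination r ^ 2 * this
    rw [e1, e2, asymLoss_mul hr, mul_pow, hA, Real.rpow_add hr, Real.rpow_natCast]
    obtain ⟨k, rfl⟩ : ∃ k, n = k + 1 := ⟨n - 1, by omega⟩
    simp only [Nat.add_sub_cancel, pow_succ]
    ring
  have hinv : IntegrableOn (fun r : ℝ => A⁻¹ * (A * (r ^ (p + n) * f (r ^ 2)))) (Ioi 0) :=
    hAint.const_mul A⁻¹
  simpa only [inv_mul_cancel_left₀ hApos.ne'] using hinv

/-- A radial moment dominates the corresponding plane integral. -/
lemma integrable_radial_halfPlane (m : ℝ) (hfm : Measurable f)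
    (h : IntegrableOn (fun r : ℝ => r ^ (m + 1) * f (r ^ 2)) (Ioi 0)) :
    Integrable (fun q : ℝ × ℝ => √(q.2 ^ 2 + q.1 ^ 2) ^ m * f (q.2 ^ 2 + q.1 ^ 2))
      halfPlane := by
  set H : ℝ × ℝ → ℝ := fun q => √(q.1 ^ 2 + q.2 ^ 2) ^ m * f (q.1 ^ 2 + q.2 ^ 2) with hH
  have hHm : Measurable H := by fun_prop
  suffices hI : Integrable H by
    exact (integrableOn_prod_swap_iff H).1 hI.integrableOn
  refine ⟨hHm.aestronglyMeasurable, ?_⟩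
  rw [HasFiniteIntegral, ← lintegral_comp_polarCoord_symm, polarCoord_target,
    Measure.volume_eq_prod, ← Measure.prod_restrict]
  have hI2 : Integrable (fun q : ℝ × ℝ => (q.1 ^ (m + 1) * f (q.1 ^ 2)) * 1)
      ((volume.restrict (Ioi (0 : ℝ))).prod (volume.restrict (Ioo (-Real.pi) Real.pi))) :=
    Integrable.mul_prod h (integrable_const _)
  refine lt_of_eq_of_lt ?_ hI2.2
  rw [Measure.prod_restrict]
  refine setLIntegral_congr_fun (measurableSet_Ioi.prod measurableSet_Ioo) fun q hq => ?_
  have hr : 0 < q.1 := hq.1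
  simp only [smul_eq_mul, mul_one]
  rw [← Real.enorm_of_nonneg hr.le, ← enorm_mul]
  congr 1
  simp only [hH, polarCoord_symm_apply]
  have e2 : (q.1 * Real.cos q.2) ^ 2 + (q.1 * Real.sin q.2) ^ 2 = q.1 ^ 2 := by
    have := Real.sin_sq_add_cos_sq q.2
    linear_combination q.1 ^ 2 * this
  rw [e2, Real.sqrt_sq hr.le, Real.rpow_add_one hr.ne']
  ring

/-- Integrability of the score-type integrands, for every slope `k`. -/
lemma integrable_score (n : ℕ) (hp : 1 ≤ p) (hf_pos : ∀ t > (0 : ℝ), 0 < f t)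
    (hfm : Measurable f)
    (h : IntegrableOn (fun r : ℝ => r ^ (p + n) * f (r ^ 2)) (Ioi 0)) (k : ℝ) :
    Integrable (fun q : ℝ × ℝ => asymLossDeriv p α β (q.2 + k * q.1) * q.1 ^ n *
      f (q.2 ^ 2 + q.1 ^ 2)) halfPlane := by
  have h1 := integrable_radial_halfPlane (f := f) (p + n - 1) hfm (by simpa using h)
  set C := (|α| + |β|) * |p| * (1 + |k|) ^ (p - 1) with hC
  refine Integrable.mono' (h1.const_mul C) ?_ ?_
  · have h2 : Measurable fun q : ℝ × ℝ => asymLossDeriv p α β (q.2 + k * q.1) :=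
      measurable_asymLossDeriv.comp (by fun_prop)
    exact (by fun_prop : Measurable _).aestronglyMeasurable
  · filter_upwards [ae_halfPlane_pos] with q hq
    set r := √(q.2 ^ 2 + q.1 ^ 2) with hr
    have hsum : 0 < q.2 ^ 2 + q.1 ^ 2 := by positivity
    have hrpos : 0 < r := Real.sqrt_pos.2 hsum
    have hfpos := hf_pos _ hsum
    have hu : |q.2| ≤ r := Real.abs_le_sqrt (by nlinarith)
    have hv : q.1 ≤ r := (le_abs_self _).trans (Real.abs_le_sqrt (by nlinarith))
    have hk : |q.2 + k * q.1| ≤ r * (1 + |k|) := by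
      calc |q.2 + k * q.1| ≤ |q.2| + |k * q.1| := abs_add_le _ _
        _ = |q.2| + |k| * q.1 := by rw [abs_mul, abs_of_pos hq]
        _ ≤ r + |k| * r := by gcongr
        _ = _ := by ring
    rw [Real.norm_eq_abs, abs_mul, abs_mul, abs_of_pos hfpos, abs_of_pos (pow_pos hq n)]
    have e : C * (r ^ (p + n - 1) * f (q.2 ^ 2 + q.1 ^ 2)) =
        (|α| + |β|) * |p| * (r * (1 + |k|)) ^ (p - 1) * r ^ n * f (q.2 ^ 2 + q.1 ^ 2) := by
      rw [Real.mul_rpow hrpos.le (by positivity), hC, add_sub_right_comm, Real.rpow_add hrpos,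
        Real.rpow_natCast]
      ring
    rw [e]
    have hle : |asymLossDeriv p α β (q.2 + k * q.1)| ≤
        (|α| + |β|) * |p| * (r * (1 + |k|)) ^ (p - 1) :=
      (abs_asymLossDeriv_le _).trans (by
        have := Real.rpow_le_rpow (abs_nonneg _) hk (z := p - 1) (by linarith)
        gcongr)
    gcongr

end Moment

/-- The integrand `ρ'(u + k v) v ^ n f(u² + v²)`, as a function of `(v, u)`. -/
noncomputable def score (p α β : ℝ) (n : ℕ) (f : ℝ → ℝ) (k : ℝ) (q : ℝ × ℝ) : ℝ :=
  asymLossDeriv p α β (q.2 + k * q.1) * q.1 ^ n * f (q.2 ^ 2 + q.1 ^ 2)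

/-- The integral of the score over `{(v, u) | 0 < v, u < v y - θ}`. -/
noncomputable def wedge (p α β : ℝ) (n : ℕ) (f : ℝ → ℝ) (k θ y : ℝ) : ℝ :=
  ∫ v in Ioi (0 : ℝ), ∫ u in Iio (v * y - θ), score p α β n f k (v, u)

section Wedge

variable {p α β : ℝ} {n : ℕ} {f : ℝ → ℝ} {k : ℝ}

lemma wedge_eq (hi : Integrable (score p α β n f k) halfPlane) (θ y : ℝ) :
    wedge p α β n f k θ y =
      ∫ q, {q : ℝ × ℝ | q.2 < q.1 * y - θ}.indicator (score p α β n f k) q ∂halfPlane := by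
  have hA : MeasurableSet {q : ℝ × ℝ | q.2 < q.1 * y - θ} :=
    measurableSet_lt (by fun_prop) (by fun_prop)
  rw [halfPlane, integral_prod _ (hi.indicator hA), wedge]
  refine integral_congr_ae (Eventually.of_forall fun v => ?_)
  simp only
  rw [← integral_indicator measurableSet_Iio]
  rfl

lemma wedge_eq_sheared (θ y : ℝ) :
    wedge p α β n f k θ y =
      ∫ v in Ioi (0 : ℝ), ∫ τ in Ioi θ, score p α β n f k (v, v * y - τ) := by
  refine integral_congr_ae (Eventually.of_forall fun v => ?_)
  simp only
  rw [← integral_indicator measurableSet_Iio, ← integral_indicator measurableSet_Ioi,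
    ← integral_sub_left_eq_self _ volume (v * y)]
  refine integral_congr_ae (Eventually.of_forall fun τ => ?_)
  have : v * y - τ ∈ Iio (v * y - θ) ↔ τ ∈ Ioi θ := by simp
  by_cases h : τ ∈ Ioi θ
  · simp only [indicator_of_mem h, indicator_of_mem (this.2 h)]
  · simp only [indicator_of_notMem h, indicator_of_notMem (mt this.1 h)]

lemma integrable_sheared (hi : Integrable (score p α β n f k) halfPlane) (y : ℝ) :
    Integrable (fun q : ℝ × ℝ => score p α β n f k (q.1, q.1 * y - q.2)) halfPlane := by
  have hmp : MeasurePreserving (fun q : ℝ × ℝ => (id q.1, q.1 * y - q.2)) halfPlane halfPlane :=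
    MeasurePreserving.skew_product (MeasurePreserving.id _) (g := fun v u => v * y - u)
      (by fun_prop) (Eventually.of_forall fun v =>
        (Measure.measurePreserving_sub_left volume (v * y)).map_eq)
  exact hmp.integrable_comp_of_integrable hi

lemma sheared_mul (y : ℝ) {τ w : ℝ} (hτ : 0 < τ) :
    score p α β n f k (τ * w, τ * w * y - τ) = τ ^ (p - 1) * τ ^ n *
      (asymLossDeriv p α β (w * (y + k) - 1) * w ^ n *
        f (τ ^ 2 * ((w * y - 1) ^ 2 + w ^ 2))) := by
  rw [score]
  have e1 : τ * w * y - τ + k * (τ * w) = τ * (w * (y + k) - 1) := by ring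
  have e2 : (τ * w * y - τ) ^ 2 + (τ * w) ^ 2 = τ ^ 2 * ((w * y - 1) ^ 2 + w ^ 2) := by ring
  simp only [e1, e2]
  rw [asymLossDeriv_mul hτ, mul_pow τ w]
  ring

/-- The inner integrals of the sheared score change sign at most once, from `+` to `-`. -/
lemma integral_sheared_nonpos {fd : ℝ → ℝ} (hp : 1 ≤ p) (hα : 0 < α) (hαβ : α ≤ β)
    (hf_pos : ∀ t > (0 : ℝ), 0 < f t)
    (hf_deriv : ∀ t > (0 : ℝ), HasDerivAt f (fd t) t)
    (hf_mlr : AntitoneOn (fun t => t * fd t / f t) (Ioi 0))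
    (y : ℝ) {a b : ℝ} (ha : 0 < a) (hab : a ≤ b)
    (hia : IntegrableOn (fun v => score p α β n f k (v, v * y - a)) (Ioi 0))
    (hib : IntegrableOn (fun v => score p α β n f k (v, v * y - b)) (Ioi 0))
    (hle : ∫ v in Ioi (0 : ℝ), score p α β n f k (v, v * y - a) ≤ 0) :
    ∫ v in Ioi (0 : ℝ), score p α β n f k (v, v * y - b) ≤ 0 := by
  have hb : 0 < b := ha.trans_le hab
  have hC : ∀ τ : ℝ, 0 < τ → 0 < τ ^ (p - 1) * τ ^ n := fun τ hτ => by positivity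
  have hI : ∀ τ : ℝ, 0 < τ → IntegrableOn (fun v => score p α β n f k (v, v * y - τ)) (Ioi 0) →
      IntegrableOn (fun w => asymLossDeriv p α β (w * (y + k) - 1) * w ^ n *
        f (τ ^ 2 * ((w * y - 1) ^ 2 + w ^ 2))) (Ioi 0) := by
    intro τ hτ h
    have h1 := (integrableOn_Ioi_comp_mul_left_iff
      (fun v => score p α β n f k (v, v * y - τ)) 0 hτ).2 (by simpa using h)
    simp only [sheared_mul y hτ] at h1
    have h2 : IntegrableOn (fun w => (τ ^ (p - 1) * τ ^ n)⁻¹ * (τ ^ (p - 1) * τ ^ n *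
        (asymLossDeriv p α β (w * (y + k) - 1) * w ^ n *
        f (τ ^ 2 * ((w * y - 1) ^ 2 + w ^ 2))))) (Ioi 0) := h1.const_mul _
    simpa only [inv_mul_cancel_left₀ (hC τ hτ).ne'] using h2
  have hE : ∀ τ : ℝ, 0 < τ → ∫ v in Ioi (0 : ℝ), score p α β n f k (v, v * y - τ) =
      τ * (τ ^ (p - 1) * τ ^ n) * ∫ w in Ioi (0 : ℝ), asymLossDeriv p α β (w * (y + k) - 1) *
        w ^ n * f (τ ^ 2 * ((w * y - 1) ^ 2 + w ^ 2)) := by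
    intro τ hτ
    have h1 := integral_comp_mul_left_Ioi (fun v => score p α β n f k (v, v * y - τ)) 0 hτ
    simp only [sheared_mul y hτ, mul_zero, smul_eq_mul] at h1
    rw [integral_const_mul] at h1
    rw [mul_assoc, h1, mul_inv_cancel_left₀ hτ.ne']
  rw [hE b hb]
  rw [hE a ha] at hle
  refine mul_nonpos_of_nonneg_of_nonpos (mul_pos hb (hC b hb)).le ?_
  refine integral_scaled_nonpos n hp hα hαβ hf_pos hf_deriv hf_mlr y (y + k)
    (pow_pos ha 2) (pow_le_pow_left₀ ha.le hab 2) (hI a ha hia) (hI b hb hib) ?_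
  exact nonpos_of_mul_nonpos_right hle (mul_pos ha (hC a ha))

/-- Nonpositivity of the wedge integral at shift `0` propagates to all positive shifts. -/
lemma wedge_nonpos {fd : ℝ → ℝ} (hp : 1 ≤ p) (hα : 0 < α) (hαβ : α ≤ β)
    (hf_pos : ∀ t > (0 : ℝ), 0 < f t)
    (hf_deriv : ∀ t > (0 : ℝ), HasDerivAt f (fd t) t)
    (hf_mlr : AntitoneOn (fun t => t * fd t / f t) (Ioi 0))
    (hi : Integrable (score p α β n f k) halfPlane) {θ : ℝ} (hθ : 0 ≤ θ) (y : ℝ)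
    (h0 : wedge p α β n f k 0 y ≤ 0) : wedge p α β n f k θ y ≤ 0 := by
  have hT := integrable_sheared hi y
  set E : ℝ → ℝ := fun τ => ∫ v in Ioi (0 : ℝ), score p α β n f k (v, v * y - τ) with hE
  have hEi : Integrable E := hT.integral_prod_right
  have hgood : ∀ᵐ τ : ℝ, IntegrableOn (fun v => score p α β n f k (v, v * y - τ)) (Ioi 0) :=
    hT.prod_left_ae
  have hW : ∀ t, wedge p α β n f k t y = ∫ τ in Ioi t, E τ := by
    intro t
    rw [wedge_eq_sheared, integral_integral_swap]
    have h1 := hT.restrict (s := univ ×ˢ Ioi t)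
    rwa [halfPlane, ← Measure.prod_restrict, Measure.restrict_univ] at h1
  by_cases hex : ∃ a, 0 < a ∧ a ≤ θ ∧
      IntegrableOn (fun v => score p α β n f k (v, v * y - a)) (Ioi 0) ∧ E a ≤ 0
  · obtain ⟨a, ha, haθ, hia, hEa⟩ := hex
    rw [hW]
    refine integral_nonpos_of_ae ?_
    filter_upwards [ae_restrict_of_ae hgood, ae_restrict_mem measurableSet_Ioi] with τ hτ hτθ
    exact integral_sheared_nonpos hp hα hαβ hf_pos hf_deriv hf_mlr y ha
      (haθ.trans (le_of_lt hτθ)) hia hτ hEa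
  · push Not at hex
    have hsplit : ∫ τ in Ioi 0, E τ = (∫ τ in Ioc 0 θ, E τ) + ∫ τ in Ioi θ, E τ := by
      rw [← setIntegral_union Ioc_disjoint_Ioi_same measurableSet_Ioi hEi.integrableOn
        hEi.integrableOn, Ioc_union_Ioi_eq_Ioi hθ]
    have hpos : 0 ≤ ∫ τ in Ioc 0 θ, E τ := by
      refine integral_nonneg_of_ae ?_
      filter_upwards [ae_restrict_of_ae hgood, ae_restrict_mem measurableSet_Ioc] with τ hτ hτθ
      exact (hex τ hτθ.1 hτθ.2 hτ).le
    rw [hW, hsplit] at h0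
    rw [hW]
    linarith

/-- Monotonicity of the wedge integral in the slope. -/
lemma wedge_mono {k' : ℝ} (hp : 1 ≤ p) (hα : 0 < α) (hβ : 0 < β)
    (hf_pos : ∀ t > (0 : ℝ), 0 < f t) (hi : Integrable (score p α β n f k) halfPlane)
    (hi' : Integrable (score p α β n f k') halfPlane) (hk : k ≤ k') (θ y : ℝ) :
    wedge p α β n f k θ y ≤ wedge p α β n f k' θ y := by
  have hA : MeasurableSet {q : ℝ × ℝ | q.2 < q.1 * y - θ} :=
    measurableSet_lt (by fun_prop) (by fun_prop)
  rw [wedge_eq hi, wedge_eq hi']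
  refine integral_mono_ae (hi.indicator hA) (hi'.indicator hA) ?_
  filter_upwards [ae_halfPlane_pos] with q hq
  refine indicator_le_indicator ?_
  have hf := (hf_pos (q.2 ^ 2 + q.1 ^ 2) (by positivity)).le
  have hle := asymLossDeriv_mono hp hα hβ (a := q.2 + k * q.1) (b := q.2 + k' * q.1)
    (by gcongr)
  unfold score
  gcongr

/-- Continuity from the left of the wedge integral. -/
lemma tendsto_wedge_left (hi : Integrable (score p α β n f k) halfPlane) (y : ℝ) :
    Tendsto (wedge p α β n f k 0) (nhdsWithin y (Iio y)) (nhds (wedge p α β n f k 0 y)) := by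
  simp only [funext (wedge_eq hi 0), wedge_eq hi 0 y]
  refine tendsto_integral_filter_of_dominated_convergence (fun q => ‖score p α β n f k q‖)
    ?_ ?_ hi.norm ?_
  · refine Eventually.of_forall fun t => (hi.indicator ?_).1
    exact measurableSet_lt (by fun_prop) (by fun_prop)
  · exact Eventually.of_forall fun t => Eventually.of_forall fun q =>
      norm_indicator_le_norm_self _ _
  · filter_upwards [ae_halfPlane_pos] with q hq
    refine tendsto_const_nhds.congr' ?_
    by_cases h : q.2 < q.1 * y
    · have h1 : ∀ᶠ t in nhds y, q.2 < q.1 * t :=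
        ((continuous_const.mul continuous_id).tendsto y).eventually_const_lt h
      filter_upwards [nhdsWithin_le_nhds h1] with t ht
      rw [indicator_of_mem, indicator_of_mem] <;> simpa
    · filter_upwards [self_mem_nhdsWithin] with t ht
      have ht : t < y := ht
      have : q.1 * t ≤ q.1 * y := by gcongr
      rw [indicator_of_notMem, indicator_of_notMem]
      · simp only [mem_ofPred_eq]; linarith
      · simpa using h

/-- The wedges exhaust the half plane. -/
lemma tendsto_wedge_atTop (hi : Integrable (score p α β n f k) halfPlane) :
    Tendsto (wedge p α β n f k 0) atTop (nhds (∫ q, score p α β n f k q ∂halfPlane)) := by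
  simp only [funext (wedge_eq hi 0)]
  refine tendsto_integral_filter_of_dominated_convergence (fun q => ‖score p α β n f k q‖)
    ?_ ?_ hi.norm ?_
  · refine Eventually.of_forall fun t => (hi.indicator ?_).1
    exact measurableSet_lt (by fun_prop) (by fun_prop)
  · exact Eventually.of_forall fun t => Eventually.of_forall fun q =>
      norm_indicator_le_norm_self _ _
  · filter_upwards [ae_halfPlane_pos] with q hq
    refine tendsto_const_nhds.congr' ?_
    filter_upwards [eventually_gt_atTop (q.2 / q.1)] with t ht
    rw [div_lt_iff₀ hq] at ht
    rw [indicator_of_mem]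
    simp only [mem_ofPred_eq]; linarith

/-- Strict monotonicity in the slope, over any region meeting the sector where the scores
have opposite signs. -/
lemma integral_indicator_score_lt {k' a b : ℝ} (hp : 1 ≤ p) (hα : 0 < α) (hβ : 0 < β)
    (hf_pos : ∀ t > (0 : ℝ), 0 < f t) (hi : Integrable (score p α β n f k) halfPlane)
    (hi' : Integrable (score p α β n f k') halfPlane) (hab : a < b) (ha : -k' ≤ a) (hb : b ≤ -k)
    {A : Set (ℝ × ℝ)} (hA : MeasurableSet A)
    (hsub : ∀ q : ℝ × ℝ, 0 < q.1 → q.1 * a < q.2 → q.2 < q.1 * b → q ∈ A) :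
    ∫ q, A.indicator (score p α β n f k) q ∂halfPlane <
      ∫ q, A.indicator (score p α β n f k') q ∂halfPlane := by
  have hk : k ≤ k' := by linarith
  have hle : ∀ᵐ q ∂halfPlane,
      A.indicator (score p α β n f k) q ≤ A.indicator (score p α β n f k') q := by
    filter_upwards [ae_halfPlane_pos] with q hq
    refine indicator_le_indicator ?_
    have hf := (hf_pos (q.2 ^ 2 + q.1 ^ 2) (by positivity)).le
    have hle := asymLossDeriv_mono hp hα hβ (a := q.2 + k * q.1) (b := q.2 + k' * q.1)
      (by gcongr)
    unfold score
    gcongr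
  refine lt_of_le_of_ne (integral_mono_ae (hi.indicator hA) (hi'.indicator hA) hle) fun heq => ?_
  have hae := (integral_eq_iff_of_ae_le (hi.indicator hA) (hi'.indicator hA) hle).1 heq
  set U : Set (ℝ × ℝ) := {q | 0 < q.1 ∧ q.1 * a < q.2 ∧ q.2 < q.1 * b} with hU
  have hUo : IsOpen U := by
    simp only [hU, ofPred_and]
    refine (isOpen_lt continuous_const continuous_fst).inter
      ((isOpen_lt ?_ ?_).inter (isOpen_lt ?_ ?_)) <;> fun_prop
  have hUne : U.Nonempty := ⟨(1, (a + b) / 2), by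
    refine ⟨?_, ?_, ?_⟩ <;> simp only <;> linarith⟩
  have hUpos : 0 < (volume : Measure (ℝ × ℝ)) U := hUo.measure_pos volume hUne
  have hUsub : U ⊆ Ioi (0 : ℝ) ×ˢ (univ : Set ℝ) := fun q hq =>
    mem_prod.2 ⟨mem_Ioi.2 hq.1, mem_univ _⟩
  have hUh : halfPlane U = volume U := by
    rw [halfPlane_eq, Measure.restrict_apply hUo.measurableSet,
      inter_eq_self_of_subset_left hUsub]
  have hne : ∀ q ∈ U, A.indicator (score p α β n f k) q ≠ A.indicator (score p α β n f k') q := by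
    rintro q ⟨h1, h2, h3⟩
    rw [indicator_of_mem (hsub q h1 h2 h3), indicator_of_mem (hsub q h1 h2 h3)]
    have hf := hf_pos (q.2 ^ 2 + q.1 ^ 2) (by positivity)
    have hn : 0 < q.1 ^ n := by positivity
    have hneg : asymLossDeriv p α β (q.2 + k * q.1) < 0 :=
      asymLossDeriv_neg hp hα (by nlinarith)
    have hpos : 0 < asymLossDeriv p α β (q.2 + k' * q.1) :=
      asymLossDeriv_pos hp hβ (by nlinarith)
    have e1 : score p α β n f k q < 0 :=
      mul_neg_of_neg_of_pos (mul_neg_of_neg_of_pos hneg hn) hf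
    have e2 : 0 < score p α β n f k' q := by unfold score; positivity
    exact (e1.trans e2).ne
  have hzero : halfPlane U = 0 := measure_mono_null (fun q hq => hne q hq) hae
  rw [hUh] at hzero
  exact hUpos.ne' hzero

end Wedge

section LayerCake

variable {p α β : ℝ} {n : ℕ} {f : ℝ → ℝ}

/-- The upper level set of an antitone function vanishing at infinity is a wedge, so the integral
of the shifted score over `{(v, u) | z < g (u / v)}` is nonpositive if the wedge integral is. -/
lemma integral_level_nonpos (hn : 1 ≤ n) {g : ℝ → ℝ} (hg : Antitone g)
    (hg_lim : Tendsto g atTop (nhds 0)) (c₀ θ : ℝ) {z : ℝ} (hz : 0 < z)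
    (hw : ∀ y, (∀ t < y, z < g t) → wedge p α β n f (c₀ + z) θ y ≤ 0) :
    ∫ q : ℝ × ℝ, (if z < g (q.2 / q.1) then asymLossDeriv p α β (q.2 - θ + c₀ * q.1 + z * q.1) *
      q.1 * (q.1 ^ (n - 1) * f ((q.2 - θ) ^ 2 + q.1 ^ 2)) else 0) ∂halfPlane ≤ 0 := by
  set Θ : ℝ × ℝ → ℝ := fun q => if z < g (q.2 / q.1) then
    asymLossDeriv p α β (q.2 - θ + c₀ * q.1 + z * q.1) * q.1 *
      (q.1 ^ (n - 1) * f ((q.2 - θ) ^ 2 + q.1 ^ 2)) else 0 with hΘ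
  by_cases hi : Integrable Θ halfPlane
  swap
  · exact (integral_undef hi).le
  set S : Set ℝ := {t | z < g t} with hS
  rcases S.eq_empty_or_nonempty with hempty | hne
  · have : Θ = fun _ => 0 := by
      funext q
      have h1 : ¬ z < g (q.2 / q.1) := fun h => by
        have : q.2 / q.1 ∈ S := h
        rw [hempty] at this
        exact this
      simp only [hΘ, if_neg h1]
    rw [this, integral_zero]
  have hbdd : BddAbove S := by
    obtain ⟨M, hM⟩ := (hg_lim.eventually_lt_const hz).exists
    refine ⟨M, fun t ht => ?_⟩
    by_contra! hlt
    exact absurd (hg hlt.le) (not_le.2 (hM.trans ht))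
  set y := sSup S with hy
  have hlow : ∀ t < y, z < g t := by
    intro t ht
    obtain ⟨t', ht', hlt⟩ := exists_lt_of_lt_csSup hne ht
    exact lt_of_lt_of_le ht' (hg hlt.le)
  have hhigh : ∀ t, y < t → ¬ z < g t := fun t ht h => absurd (le_csSup hbdd h) (not_le.2 ht)
  refine le_of_eq_of_le ?_ (hw y hlow)
  rw [halfPlane] at hi ⊢
  rw [integral_prod _ hi, wedge]
  refine setIntegral_congr_fun measurableSet_Ioi fun v hv => ?_
  have hv : 0 < v := hv
  rw [← integral_indicator measurableSet_Iio]
  refine Eq.trans ?_ (integral_sub_right_eq_self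
    ((Iio (v * y - θ)).indicator fun u => score p α β n f (c₀ + z) (v, u)) θ)
  have hae : ∀ᵐ u : ℝ, u ≠ v * y := compl_mem_ae_iff.2 (measure_singleton _)
  refine integral_congr_ae ?_
  filter_upwards [hae] with u hu
  rcases lt_or_gt_of_ne hu with hlt | hgt
  · have h1 : u / v < y := by rw [div_lt_iff₀ hv]; linarith
    rw [indicator_of_mem (by simpa using hlt)]
    simp only [hΘ, if_pos (hlow _ h1), score]
    have e : u - θ + (c₀ + z) * v = u - θ + c₀ * v + z * v := by ring
    obtain ⟨j, rfl⟩ : ∃ j, n = j + 1 := ⟨n - 1, by omega⟩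
    rw [e, Nat.add_sub_cancel, pow_succ]
    ring
  · have h1 : y < u / v := by rw [lt_div_iff₀ hv]; linarith
    rw [indicator_of_notMem (by simpa using hgt.le)]
    simp only [hΘ, if_neg (hhigh _ h1)]

/-- Risk comparison by integrating along `z ↦ c₀ + z`, from the MRE estimator to `δ_g`. -/
lemma integral_loss_le (hn : 1 ≤ n) (hp : 1 ≤ p) (hα : 0 < α) (hβ : 0 < β)
    (hf_pos : ∀ t > (0 : ℝ), 0 < f t) (hfm : Measurable f) {g : ℝ → ℝ} (hg : Antitone g)
    (hg_lim : Tendsto g atTop (nhds 0)) (c₀ θ : ℝ)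
    (hi0 : Integrable (fun q : ℝ × ℝ => asymLoss p α β (q.2 - θ + c₀ * q.1) *
      (q.1 ^ (n - 1) * f ((q.2 - θ) ^ 2 + q.1 ^ 2))) halfPlane)
    (hig : Integrable (fun q : ℝ × ℝ =>
      asymLoss p α β (q.2 - θ + c₀ * q.1 + g (q.2 / q.1) * q.1) *
      (q.1 ^ (n - 1) * f ((q.2 - θ) ^ 2 + q.1 ^ 2))) halfPlane)
    (hw : ∀ z > 0, ∀ y, (∀ t < y, z < g t) → wedge p α β n f (c₀ + z) θ y ≤ 0) :
    ∫ q : ℝ × ℝ, asymLoss p α β (q.2 - θ + c₀ * q.1 + g (q.2 / q.1) * q.1) *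
      (q.1 ^ (n - 1) * f ((q.2 - θ) ^ 2 + q.1 ^ 2)) ∂halfPlane ≤
    ∫ q : ℝ × ℝ, asymLoss p α β (q.2 - θ + c₀ * q.1) *
      (q.1 ^ (n - 1) * f ((q.2 - θ) ^ 2 + q.1 ^ 2)) ∂halfPlane := by
  have hg0 : ∀ t, 0 ≤ g t := fun t => hg.le_of_tendsto hg_lim t
  have hgm : Measurable g := hg.measurable
  set W : ℝ × ℝ → ℝ := fun q => q.1 ^ (n - 1) * f ((q.2 - θ) ^ 2 + q.1 ^ 2) with hW
  set A : ℝ × ℝ → ℝ := fun q => q.2 - θ + c₀ * q.1 with hA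
  set G : ℝ × ℝ → ℝ := fun q => g (q.2 / q.1) with hG
  have hGm : Measurable G := hgm.comp (by fun_prop)
  have hWpos : ∀ q : ℝ × ℝ, 0 < q.1 → 0 < W q := fun q hq =>
    mul_pos (by positivity) (hf_pos _ (by positivity))
  set Θ : (ℝ × ℝ) × ℝ → ℝ := fun r => if r.2 < G r.1 then
    asymLossDeriv p α β (A r.1 + r.2 * r.1.1) * r.1.1 * W r.1 else 0 with hΘ
  have hΘm : Measurable Θ := by
    refine Measurable.ite (measurableSet_lt measurable_snd (hGm.comp measurable_fst)) ?_
      measurable_const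
    have h1 : Measurable fun r : (ℝ × ℝ) × ℝ => asymLossDeriv p α β (A r.1 + r.2 * r.1.1) :=
      measurable_asymLossDeriv.comp (by fun_prop)
    fun_prop
  have hslice : ∀ q : ℝ × ℝ, (fun z => Θ (q, z)) = (Iio (G q)).indicator
      (fun z => asymLossDeriv p α β (A q + z * q.1) * q.1 * W q) := by
    intro q; funext z
    by_cases h : z < G q
    · rw [indicator_of_mem (mem_Iio.2 h)]; simp only [hΘ, if_pos h]
    · rw [indicator_of_notMem (by simpa using h)]; simp only [hΘ, if_neg h]
  have hsliceInt : ∀ q : ℝ × ℝ, 0 < q.1 → ∫ z in Ioi (0 : ℝ), Θ (q, z) =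
      (asymLoss p α β (A q + G q * q.1) - asymLoss p α β (A q)) * W q := by
    intro q hq
    rw [hslice, setIntegral_indicator measurableSet_Iio, Ioi_inter_Iio, integral_mul_const,
      (integral_asymLossDeriv_line hp (A q) hq (hg0 _)).2]
  have hsliceInt' : ∀ q : ℝ × ℝ, 0 < q.1 → ∫ z in Ioi (0 : ℝ), ‖Θ (q, z)‖ =
      (asymLoss p (-α) β (A q + G q * q.1) - asymLoss p (-α) β (A q)) * W q := by
    intro q hq
    have e : (fun z => ‖Θ (q, z)‖) = (Iio (G q)).indicator
        (fun z => asymLossDeriv p (-α) β (A q + z * q.1) * q.1 * W q) := by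
      funext z
      rw [show Θ (q, z) = (fun z => Θ (q, z)) z from rfl, hslice, norm_indicator_eq_indicator_norm]
      congr 1
      funext z
      rw [Real.norm_eq_abs, abs_mul, abs_mul, abs_asymLossDeriv hp hα hβ, abs_of_pos hq,
        abs_of_pos (hWpos q hq)]
    rw [e, setIntegral_indicator measurableSet_Iio, Ioi_inter_Iio, integral_mul_const,
      (integral_asymLossDeriv_line hp (A q) hq (hg0 _)).2]
  have hΘi : Integrable Θ (halfPlane.prod (volume.restrict (Ioi 0))) := by
    rw [integrable_prod_iff hΘm.aestronglyMeasurable]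
    constructor
    · filter_upwards [ae_halfPlane_pos] with q hq
      rw [hslice, integrable_indicator_iff measurableSet_Iio, IntegrableOn,
        Measure.restrict_restrict measurableSet_Iio, inter_comm, Ioi_inter_Iio]
      exact (integral_asymLossDeriv_line hp (A q) hq (hg0 _)).1.mul_const _
    · refine Integrable.mono' (hig.add hi0)
        hΘm.norm.aestronglyMeasurable.integral_prod_right' ?_
      filter_upwards [ae_halfPlane_pos] with q hq
      rw [Real.norm_of_nonneg (integral_nonneg fun _ => norm_nonneg _), hsliceInt' q hq]
      have hab : ∀ t, |asymLoss p (-α) β t| = asymLoss p α β t := by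
        intro t
        rcases lt_or_ge t 0 with ht | ht
        · have : 0 < (-t) ^ p := Real.rpow_pos_of_pos (by linarith) _
          rw [asymLoss_of_neg ht, asymLoss_of_neg ht, neg_mul, abs_neg, abs_of_pos (by positivity)]
        · rw [asymLoss_of_nonneg ht, asymLoss_of_nonneg ht, abs_of_nonneg (by positivity)]
      have h1 := (le_abs_self (asymLoss p (-α) β (A q + G q * q.1))).trans_eq (hab _)
      have h2 := (neg_le_abs (asymLoss p (-α) β (A q))).trans_eq (hab _)
      simp only [Pi.add_apply]
      rw [← add_mul]
      exact mul_le_mul_of_nonneg_right (by linarith) (hWpos q hq).le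
  have hkey : ∫ q, (asymLoss p α β (A q + G q * q.1) * W q - asymLoss p α β (A q) * W q)
      ∂halfPlane = ∫ z in Ioi (0 : ℝ), ∫ q, Θ (q, z) ∂halfPlane := by
    rw [← integral_integral_swap (f := fun q z => Θ (q, z)) hΘi]
    refine integral_congr_ae ?_
    filter_upwards [ae_halfPlane_pos] with q hq
    rw [hsliceInt q hq]; ring
  rw [integral_sub hig hi0] at hkey
  have hneg : ∫ z in Ioi (0 : ℝ), ∫ q, Θ (q, z) ∂halfPlane ≤ 0 :=
    setIntegral_nonpos measurableSet_Ioi fun z hz =>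
      integral_level_nonpos hn hg hg_lim c₀ θ hz (hw z hz)
  linarith

end LayerCake

section Risk

variable {p α β : ℝ} {n : ℕ} {f : ℝ → ℝ}

/-- Scale equivariant estimators have a risk depending on `μ / σ` only. -/
lemma risk_eq_risk_div (hn : 1 ≤ n) (f ρ : ℝ → ℝ) {δ : ℝ → ℝ → ℝ} (μ : ℝ) {σ : ℝ} (hσ : 0 < σ)
    (hδ : ∀ x s, δ (σ * x) (σ * s) = σ * δ x s) :
    risk n f ρ δ μ σ = risk n f ρ δ (μ / σ) 1 := by
  unfold risk
  have h1 := integral_comp_mul_left_Ioi (fun s => ∫ x : ℝ,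
    ρ ((δ x s - μ) / σ) * (s ^ (n - 1) / σ ^ (n + 1) * f (((x - μ) ^ 2 + s ^ 2) / σ ^ 2))) 0 hσ
  rw [mul_zero, smul_eq_mul, eq_inv_mul_iff_mul_eq₀ hσ.ne'] at h1
  rw [← h1, ← integral_const_mul]
  refine integral_congr_ae (Eventually.of_forall fun s => ?_)
  simp only
  have h2 := Measure.integral_comp_mul_left (fun x => ρ ((δ x (σ * s) - μ) / σ) *
    ((σ * s) ^ (n - 1) / σ ^ (n + 1) * f (((x - μ) ^ 2 + (σ * s) ^ 2) / σ ^ 2))) σ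
  rw [abs_of_pos (inv_pos.2 hσ), smul_eq_mul, eq_inv_mul_iff_mul_eq₀ hσ.ne'] at h2
  rw [← h2, ← integral_const_mul, ← integral_const_mul]
  refine integral_congr_ae (Eventually.of_forall fun x => ?_)
  simp only
  have e1 : (δ (σ * x) (σ * s) - μ) / σ = (δ x s - μ / σ) / 1 := by
    rw [hδ]; field_simp
  have e2 : ((σ * x - μ) ^ 2 + (σ * s) ^ 2) / σ ^ 2 = ((x - μ / σ) ^ 2 + s ^ 2) / 1 ^ 2 := by
    field_simp
  rw [e1, e2]
  obtain ⟨j, rfl⟩ : ∃ j, n = j + 1 := ⟨n - 1, by omega⟩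
  simp only [Nat.add_sub_cancel, one_pow, div_one, mul_pow, pow_succ]
  field_simp

lemma risk_one_eq {ρ : ℝ → ℝ} (h : ℝ → ℝ) (c₀ θ : ℝ)
    (hi : Integrable (fun q : ℝ × ℝ => ρ (q.2 - θ + c₀ * q.1 + h (q.2 / q.1) * q.1) *
      (q.1 ^ (n - 1) * f ((q.2 - θ) ^ 2 + q.1 ^ 2))) halfPlane) :
    risk n f ρ (fun x s => x + c₀ * s + h (x / s) * s) θ 1 =
      ∫ q : ℝ × ℝ, ρ (q.2 - θ + c₀ * q.1 + h (q.2 / q.1) * q.1) *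
        (q.1 ^ (n - 1) * f ((q.2 - θ) ^ 2 + q.1 ^ 2)) ∂halfPlane := by
  rw [halfPlane] at hi ⊢
  rw [integral_prod _ hi, risk]
  refine integral_congr_ae (Eventually.of_forall fun s => ?_)
  refine integral_congr_ae (Eventually.of_forall fun x => ?_)
  have e : x + c₀ * s + h (x / s) * s - θ = x - θ + c₀ * s + h (x / s) * s := by ring
  simp only [div_one, one_pow, e]

lemma integrable_loss_one {ρ : ℝ → ℝ} (h : ℝ → ℝ) (c₀ θ : ℝ)
    (hi : IntegrableOn (fun q : ℝ × ℝ =>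
        ρ ((q.1 + c₀ * q.2 + h (q.1 / q.2) * q.2 - θ) / 1) *
          (q.2 ^ (n - 1) / 1 ^ (n + 1) * f (((q.1 - θ) ^ 2 + q.2 ^ 2) / 1 ^ 2)))
      (univ ×ˢ Ioi 0)) :
    Integrable (fun q : ℝ × ℝ => ρ (q.2 - θ + c₀ * q.1 + h (q.2 / q.1) * q.1) *
      (q.1 ^ (n - 1) * f ((q.2 - θ) ^ 2 + q.1 ^ 2))) halfPlane := by
  refine ((integrableOn_prod_swap_iff _).1 hi).congr (Eventually.of_forall fun q => ?_)
  have e : q.2 + c₀ * q.1 + h (q.2 / q.1) * q.1 - θ =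
    q.2 - θ + c₀ * q.1 + h (q.2 / q.1) * q.1 := by ring
  simp only [div_one, one_pow, e]

/-- The generalized Bayes function is antitone. -/
lemma bayes_antitone (hp : 1 ≤ p) (hα : 0 < α) (hβ : 0 < β)
    (hf_pos : ∀ t > (0 : ℝ), 0 < f t)
    (hi : ∀ k, Integrable (score p α β n f k) halfPlane) {c₀ : ℝ} {gpi : ℝ → ℝ}
    (hgpi : ∀ y, wedge p α β n f (c₀ + gpi y) 0 y = 0)
    (hgpi_pos : ∀ y : ℝ, 0 ≤ y + c₀ + gpi y) : Antitone gpi := by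
  intro y y' hyy'
  by_contra! hlt
  rcases hyy'.eq_or_lt with rfl | hyy'
  · exact lt_irrefl _ hlt
  have hA : ∀ y : ℝ, MeasurableSet {q : ℝ × ℝ | q.2 < q.1 * y - 0} := fun y =>
    measurableSet_lt (by fun_prop) (by fun_prop)
  have h1 : wedge p α β n f (c₀ + gpi y) 0 y' < wedge p α β n f (c₀ + gpi y') 0 y' := by
    rw [wedge_eq (hi _), wedge_eq (hi _)]
    refine integral_indicator_score_lt hp hα hβ hf_pos (hi _) (hi _)
      (a := -(c₀ + gpi y')) (b := -(c₀ + gpi y)) (by linarith) le_rfl le_rfl (hA y') ?_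
    intro q hq _ h2
    have h3 : q.1 * -(c₀ + gpi y) < q.1 * y' := by
      have := hgpi_pos y
      exact mul_lt_mul_of_pos_left (by linarith) hq
    simp only [mem_ofPred_eq]
    linarith
  have h2 : wedge p α β n f (c₀ + gpi y) 0 y ≤ wedge p α β n f (c₀ + gpi y) 0 y' := by
    rw [wedge_eq (hi _), wedge_eq (hi _)]
    refine integral_mono_ae ((hi _).indicator (hA y)) ((hi _).indicator (hA y')) ?_
    filter_upwards [ae_halfPlane_pos] with q hq
    have hm : q.1 * y < q.1 * y' := mul_lt_mul_of_pos_left hyy' hq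
    by_cases h3 : q.2 < q.1 * y
    · rw [indicator_of_mem, indicator_of_mem] <;> simp only [mem_ofPred_eq] <;> linarith
    · rw [indicator_of_notMem (by simpa using h3)]
      rw [indicator_apply]
      split_ifs with h4
      · have h5 : 0 ≤ q.1 * (y + c₀ + gpi y) := mul_nonneg hq.le (hgpi_pos y)
        have h6 : 0 ≤ q.2 + (c₀ + gpi y) * q.1 := by linarith
        exact mul_nonneg (mul_nonneg (asymLossDeriv_nonneg hp hβ.le h6) (by positivity))
          (hf_pos _ (by positivity)).le
      · exact le_rfl
  rw [hgpi] at h1 h2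
  linarith

/-- The generalized Bayes function vanishes at infinity. -/
lemma bayes_tendsto (hp : 1 ≤ p) (hα : 0 < α) (hβ : 0 < β)
    (hf_pos : ∀ t > (0 : ℝ), 0 < f t)
    (hi : ∀ k, Integrable (score p α β n f k) halfPlane) {c₀ : ℝ} {gpi : ℝ → ℝ}
    (hc₀ : ∫ q, score p α β n f c₀ q ∂halfPlane = 0)
    (hgpi : ∀ y, wedge p α β n f (c₀ + gpi y) 0 y = 0)
    (hanti : Antitone gpi) : Tendsto gpi atTop (nhds 0) := by
  have hstrict : ∀ k k', k < k' →
      ∫ q, score p α β n f k q ∂halfPlane < ∫ q, score p α β n f k' q ∂halfPlane := by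
    intro k k' hk
    have := integral_indicator_score_lt hp hα hβ hf_pos (hi k) (hi k')
      (a := -k') (b := -k) (by linarith) le_rfl le_rfl MeasurableSet.univ (fun q _ _ _ => mem_univ q)
    simpa only [indicator_univ] using this
  have hnonneg : ∀ y, 0 ≤ gpi y := by
    intro y
    by_contra! hneg
    have h1 : 0 ≤ ∫ q, score p α β n f (c₀ + gpi y) q ∂halfPlane := by
      refine ge_of_tendsto (tendsto_wedge_atTop (hi _)) ?_
      filter_upwards [eventually_ge_atTop y] with t ht
      exact (hgpi t).symm.trans_le
        (wedge_mono hp hα hβ hf_pos (hi _) (hi _) (by linarith [hanti ht]) 0 t)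
    have h2 := hstrict (c₀ + gpi y) c₀ (by linarith)
    linarith
  refine tendsto_order.2 ⟨fun a ha => Eventually.of_forall fun y => ha.trans_le (hnonneg y), ?_⟩
  intro ε hε
  by_contra hcon
  have hge : ∀ y, ε ≤ gpi y := by
    intro y
    by_contra! hlt
    refine hcon ?_
    filter_upwards [eventually_ge_atTop y] with t ht using (hanti ht).trans_lt hlt
  have h1 : ∫ q, score p α β n f (c₀ + ε) q ∂halfPlane ≤ 0 := by
    refine le_of_tendsto (tendsto_wedge_atTop (hi _)) (Eventually.of_forall fun t => ?_)
    exact (wedge_mono hp hα hβ hf_pos (hi _) (hi _) (by linarith [hge t]) 0 t).trans_eq (hgpi t)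
  have h2 := hstrict c₀ (c₀ + ε) (by linarith)
  linarith

/-- An antitone function that vanishes at infinity and stays below the generalized Bayes function
yields an estimator dominating the MRE estimator. -/
lemma risk_le_risk_mre (hn : 1 ≤ n) (hp : 1 ≤ p) (hα : 0 < α) (hαβ : α ≤ β) {fd : ℝ → ℝ}
    (hf_pos : ∀ t > (0 : ℝ), 0 < f t)
    (hf_deriv : ∀ t > (0 : ℝ), HasDerivAt f (fd t) t)
    (hf_mlr : AntitoneOn (fun t => t * fd t / f t) (Ioi 0)) (hfm : Measurable f)
    (hi : ∀ k, Integrable (score p α β n f k) halfPlane) {c₀ : ℝ} {g gpi : ℝ → ℝ}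
    (hgpi : ∀ y, wedge p α β n f (c₀ + gpi y) 0 y = 0)
    (hg : Antitone g) (hg_lim : Tendsto g atTop (nhds 0)) (hg_le : ∀ y, g y ≤ gpi y)
    (hi0 : ∀ θ ≥ (0 : ℝ), Integrable (fun q : ℝ × ℝ =>
      asymLoss p α β (q.2 - θ + c₀ * q.1 + 0 * q.1) *
      (q.1 ^ (n - 1) * f ((q.2 - θ) ^ 2 + q.1 ^ 2))) halfPlane)
    (hig : ∀ θ ≥ (0 : ℝ), Integrable (fun q : ℝ × ℝ =>
      asymLoss p α β (q.2 - θ + c₀ * q.1 + g (q.2 / q.1) * q.1) *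
      (q.1 ^ (n - 1) * f ((q.2 - θ) ^ 2 + q.1 ^ 2))) halfPlane)
    {μ σ : ℝ} (hμ : 0 ≤ μ) (hσ : 0 < σ) :
    risk n f (asymLoss p α β) (fun x s => x + c₀ * s + g (x / s) * s) μ σ ≤
      risk n f (asymLoss p α β) (fun x s => x + c₀ * s) μ σ := by
  have hβ : 0 < β := hα.trans_le hαβ
  have hθ : 0 ≤ μ / σ := by positivity
  have h0 := risk_one_eq (fun _ => 0) c₀ (μ / σ) (hi0 _ hθ)
  simp only [zero_mul, add_zero] at h0 hi0
  rw [risk_eq_risk_div hn _ _ μ hσ (fun x s => by rw [mul_div_mul_left _ _ hσ.ne']; ring),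
    risk_eq_risk_div hn _ _ μ hσ (fun x s => by ring), h0, risk_one_eq g c₀ (μ / σ) (hig _ hθ)]
  refine integral_loss_le hn hp hα hβ hf_pos hfm hg hg_lim c₀ (μ / σ) (hi0 _ hθ) (hig _ hθ) ?_
  intro z _ y hy
  refine wedge_nonpos hp hα hαβ hf_pos hf_deriv hf_mlr (hi _) hθ y ?_
  refine le_of_tendsto (tendsto_wedge_left (hi _) y) ?_
  filter_upwards [self_mem_nhdsWithin] with t ht
  exact (wedge_mono hp hα hβ hf_pos (hi _) (hi _) (by linarith [hy t ht, hg_le t]) 0 t).trans_eq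
    (hgpi t)

/-- The risk depends on `f` only through its values on the positive half line. -/
lemma risk_congr {f' : ℝ → ℝ} (h : ∀ t > (0 : ℝ), f t = f' t) (ρ : ℝ → ℝ) (δ : ℝ → ℝ → ℝ)
    (μ : ℝ) {σ : ℝ} (hσ : 0 < σ) : risk n f ρ δ μ σ = risk n f' ρ δ μ σ := by
  refine setIntegral_congr_fun measurableSet_Ioi fun s hs => ?_
  have hs : 0 < s := hs
  refine integral_congr_ae (Eventually.of_forall fun x => ?_)
  simp only
  rw [h _ (by positivity)]

end Risk

/-- Theorem 4: under the asymmetric `L^p` loss `ρ_{c₁,c₂}` with `p ≥ 1` and `c₂ ≥ c₁ > 0`,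
for any model density `f` satisfying the model assumption, any `δ_g ∈ C` with `g ≤ g_{π0}`
dominates the MRE estimator `δ₀(x,s) = x + c₀ s` on `{μ ≥ 0, σ > 0}`;
in particular `δ_{π0}` dominates `δ₀`. -/
theorem stmt3
    (n : ℕ) (hn : 1 ≤ n)
    (p : ℝ) (hp : 1 ≤ p)
    (c₁ c₂ : ℝ) (hc₁ : 0 < c₁) (hc₁₂ : c₁ ≤ c₂)
    -- the model assumption on f, and the normalization
    (f fd : ℝ → ℝ)
    (hf_pos : ∀ t > (0 : ℝ), 0 < f t)
    (hf_deriv : ∀ t > (0 : ℝ), HasDerivAt f (fd t) t)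
    (hfd_neg : ∀ t > (0 : ℝ), fd t < 0)
    (hf_mlr : AntitoneOn (fun t => t * fd t / f t) (Ioi 0))
    (hf_norm : (∫ s in Ioi (0 : ℝ), ∫ x : ℝ, s ^ (n - 1) * f (x ^ 2 + s ^ 2)) = 1)
    -- the asymmetric L^p loss ρ_{c₁,c₂} and its derivative
    (ρ ρd : ℝ → ℝ)
    (hρ_def : ∀ t : ℝ, ρ t = if t < 0 then c₁ * |t| ^ p else c₂ * t ^ p)
    (hρd_def : ∀ t : ℝ, ρd t = if t < 0 then -(c₁ * p * |t| ^ (p - 1)) else c₂ * p * t ^ (p - 1))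
    -- c₀ is the MRE constant
    (c₀ : ℝ)
    (hc₀ : (∫ v in Ioi (0 : ℝ), ∫ u : ℝ,
        ρd (u + c₀ * v) * v ^ n * f (u ^ 2 + v ^ 2)) = 0)
    -- g_{π0} is the generalized Bayes function for this loss:
    -- B_n(y, g_{π0}(y)) = 0 and y + c₀ + g_{π0}(y) ≥ 0 for every y
    (gpi : ℝ → ℝ)
    (hgpi_eq : ∀ y : ℝ, (∫ v in Ioi (0 : ℝ), ∫ u in Iio (v * y),
        ρd (u + c₀ * v + gpi y * v) * v ^ n * f (u ^ 2 + v ^ 2)) = 0)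
    (hgpi_pos : ∀ y : ℝ, 0 ≤ y + c₀ + gpi y)
    -- δ_g belongs to the class C
    (g g' : ℝ → ℝ)
    (hg_ftc : ∀ a b : ℝ, g b - g a = ∫ y in a..b, g' y)
    (hg_anti : Antitone g)
    (hg_nonconst : ∃ a b : ℝ, g a ≠ g b)
    (hg_lim : Tendsto g atTop (nhds 0))
    -- the threshold condition g ≤ g_{π0}
    (hg_le : ∀ y : ℝ, g y ≤ gpi y)
    -- all risks below are finite
    (h_int0 : ∀ μ ≥ (0 : ℝ), ∀ σ > (0 : ℝ), IntegrableOn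
      (fun q : ℝ × ℝ =>
        ρ ((q.1 + c₀ * q.2 - μ) / σ) *
          (q.2 ^ (n - 1) / σ ^ (n + 1) * f (((q.1 - μ) ^ 2 + q.2 ^ 2) / σ ^ 2)))
      (univ ×ˢ Ioi 0))
    (h_intg : ∀ μ ≥ (0 : ℝ), ∀ σ > (0 : ℝ), IntegrableOn
      (fun q : ℝ × ℝ =>
        ρ ((q.1 + c₀ * q.2 + g (q.1 / q.2) * q.2 - μ) / σ) *
          (q.2 ^ (n - 1) / σ ^ (n + 1) * f (((q.1 - μ) ^ 2 + q.2 ^ 2) / σ ^ 2)))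
      (univ ×ˢ Ioi 0))
    (h_intgpi : ∀ μ ≥ (0 : ℝ), ∀ σ > (0 : ℝ), IntegrableOn
      (fun q : ℝ × ℝ =>
        ρ ((q.1 + c₀ * q.2 + gpi (q.1 / q.2) * q.2 - μ) / σ) *
          (q.2 ^ (n - 1) / σ ^ (n + 1) * f (((q.1 - μ) ^ 2 + q.2 ^ 2) / σ ^ 2)))
      (univ ×ˢ Ioi 0)) :
    (∀ μ ≥ (0 : ℝ), ∀ σ > (0 : ℝ),
      risk n f ρ (fun x s => x + c₀ * s + g (x / s) * s) μ σ ≤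
        risk n f ρ (fun x s => x + c₀ * s) μ σ) ∧
    (∀ μ ≥ (0 : ℝ), ∀ σ > (0 : ℝ),
      risk n f ρ (fun x s => x + c₀ * s + gpi (x / s) * s) μ σ ≤
        risk n f ρ (fun x s => x + c₀ * s) μ σ) := by
  obtain rfl : ρ = asymLoss p c₁ c₂ := funext hρ_def
  obtain rfl : ρd = asymLossDeriv p c₁ c₂ := funext hρd_def
  have hc₂ : 0 < c₂ := hc₁.trans_le hc₁₂
  -- Replacing `f` by `0` off the positive half line makes it measurable.
  set F : ℝ → ℝ := (Ioi 0).indicator f with hF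
  have hfF : ∀ t > (0 : ℝ), f t = F t := fun t ht => (indicator_of_mem (mem_Ioi.2 ht) f).symm
  have hFm : Measurable F := by
    have hcont : ContinuousOn f (Ioi 0) := fun t ht =>
      (hf_deriv t ht).continuousAt.continuousWithinAt
    classical
    rw [hF, ← piecewise_eq_indicator]
    exact hcont.measurable_piecewise continuousOn_const measurableSet_Ioi
  have hF_pos : ∀ t > (0 : ℝ), 0 < F t := fun t ht => hfF t ht ▸ hf_pos t ht
  have hF_deriv : ∀ t > (0 : ℝ), HasDerivAt F (fd t) t := fun t ht =>
    (hf_deriv t ht).congr_of_eventuallyEq <| by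
      filter_upwards [lt_mem_nhds ht] with s hs using (hfF s hs).symm
  have hF_mlr : AntitoneOn (fun t => t * fd t / F t) (Ioi 0) :=
    hf_mlr.congr fun t ht => by simp only [hfF t ht]
  have hloss : ∀ h : ℝ → ℝ, (∀ μ ≥ (0 : ℝ), ∀ σ > (0 : ℝ), IntegrableOn
      (fun q : ℝ × ℝ => asymLoss p c₁ c₂ ((q.1 + c₀ * q.2 + h (q.1 / q.2) * q.2 - μ) / σ) *
        (q.2 ^ (n - 1) / σ ^ (n + 1) * f (((q.1 - μ) ^ 2 + q.2 ^ 2) / σ ^ 2)))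
      (univ ×ˢ Ioi 0)) → ∀ θ ≥ (0 : ℝ), Integrable (fun q : ℝ × ℝ =>
        asymLoss p c₁ c₂ (q.2 - θ + c₀ * q.1 + h (q.2 / q.1) * q.1) *
        (q.1 ^ (n - 1) * F ((q.2 - θ) ^ 2 + q.1 ^ 2))) halfPlane := by
    intro h hh θ hθ
    refine integrable_loss_one h c₀ θ ((hh θ hθ 1 one_pos).congr_fun (fun q hq => ?_)
      (MeasurableSet.univ.prod measurableSet_Ioi))
    have hq : 0 < q.2 := hq.2
    simp only
    rw [hfF _ (by positivity)]
  have hi0 := hloss (fun _ => 0) (by simpa only [zero_mul, add_zero] using h_int0)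
  have hi : ∀ k, Integrable (score p c₁ c₂ n F k) halfPlane :=
    integrable_score n hp hF_pos hFm (integrableOn_radial n hn hc₁ hc₂ hFm c₀
      (by simpa only [zero_mul, add_zero, sub_zero] using hi0 0 le_rfl))
  have hbayes : ∀ y, wedge p c₁ c₂ n F (c₀ + gpi y) 0 y = 0 := by
    intro y
    refine Eq.trans ?_ (hgpi_eq y)
    refine setIntegral_congr_fun measurableSet_Ioi fun v hv => ?_
    have hv : 0 < v := hv
    simp only [sub_zero]
    refine integral_congr_ae (Eventually.of_forall fun u => ?_)
    simp only [score]
    rw [hfF _ (by positivity), add_mul, add_assoc]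
  have hmre : ∫ q, score p c₁ c₂ n F c₀ q ∂halfPlane = 0 := by
    have hi_prod := hi c₀
    rw [halfPlane] at hi_prod ⊢
    rw [integral_prod _ hi_prod]
    refine Eq.trans ?_ hc₀
    refine setIntegral_congr_fun measurableSet_Ioi fun v hv => ?_
    have hv : 0 < v := hv
    refine integral_congr_ae (Eventually.of_forall fun u => ?_)
    simp only [score]
    rw [hfF _ (by positivity)]
  have hdom : ∀ h : ℝ → ℝ, Antitone h → Tendsto h atTop (nhds 0) → (∀ y, h y ≤ gpi y) →
      (∀ θ ≥ (0 : ℝ), Integrable (fun q : ℝ × ℝ =>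
        asymLoss p c₁ c₂ (q.2 - θ + c₀ * q.1 + h (q.2 / q.1) * q.1) *
        (q.1 ^ (n - 1) * F ((q.2 - θ) ^ 2 + q.1 ^ 2))) halfPlane) →
      ∀ μ ≥ (0 : ℝ), ∀ σ > (0 : ℝ),
        risk n f (asymLoss p c₁ c₂) (fun x s => x + c₀ * s + h (x / s) * s) μ σ ≤
          risk n f (asymLoss p c₁ c₂) (fun x s => x + c₀ * s) μ σ := by
    intro h h_anti h_lim h_le h_int μ hμ σ hσ
    rw [risk_congr hfF _ _ μ hσ, risk_congr hfF _ _ μ hσ]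
    exact risk_le_risk_mre hn hp hc₁ hc₁₂ hF_pos hF_deriv hF_mlr hFm hi hbayes h_anti h_lim h_le
      hi0 h_int hμ hσ
  have hgpi_anti := bayes_antitone hp hc₁ hc₂ hF_pos hi hbayes hgpi_pos
  exact ⟨hdom g hg_anti hg_lim hg_le (hloss g h_intg),
    hdom gpi hgpi_anti (bayes_tendsto hp hc₁ hc₂ hF_pos hi hmre hbayes hgpi_anti)
      (fun _ => le_rfl) (hloss gpi h_intgpi)⟩
end

section
/- Let p > 0, c₁ > 0, c₂ > 0, q ∈ ℝ, y ∈ ℝ, and let f : (0,∞) → [0,∞) be measurable with 0 < ∫₀^∞ x^{(q+p-1)/2} f(x) dx < ∞, and assume ∫_{-∞}^{y} ρ_{c₁,c₂}(t+h)(1+t²)^{-(q+p+1)/2} dt < ∞ for every h ∈ ℝ. Then h* ∈ ℝ minimizes h ↦ ∫₀^∞∫_{-∞}^{vy} ρ_{c₁,c₂}(u+hv) v^{q-1} f(u²+v²) du dv if and only if h* minimizes h ↦ ∫_{-∞}^{y} ρ_{c₁,c₂}(t+h)(1+t²)^{-(q+p+1)/2} dt. In particular the set of minimizers does not depend on f,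 i.e., the generalized Bayes estimator δ_{π_l} under loss ρ_{c₁,c₂} is the same for every such model density f. -/
open MeasureTheory Set

/-- The asymmetric `L^p` loss `ρ_{c₁,c₂}(t) = c₁|t|^p` for `t < 0` and `c₂ t^p` for `t ≥ 0`. -/
noncomputable def rhoAsym (p c₁ c₂ : ℝ) (t : ℝ) : ℝ :=
  if t < 0 then c₁ * |t| ^ p else c₂ * t ^ p

theorem rhoAsym_nonneg {p c₁ c₂ : ℝ} (hc₁ : 0 ≤ c₁) (hc₂ : 0 ≤ c₂) (t : ℝ) :
    0 ≤ rhoAsym p c₁ c₂ t := by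
  unfold rhoAsym
  split_ifs with ht
  · positivity
  · have := not_lt.mp ht
    positivity

theorem measurable_rhoAsym (p c₁ c₂ : ℝ) : Measurable (rhoAsym p c₁ c₂) := by
  unfold rhoAsym
  exact Measurable.ite measurableSet_Iio (by fun_prop) (by fun_prop)

theorem rhoAsym_mul (p c₁ c₂ : ℝ) {v : ℝ} (hv : 0 < v) (t : ℝ) :
    rhoAsym p c₁ c₂ (v * t) = v ^ p * rhoAsym p c₁ c₂ t := by
  unfold rhoAsym
  rcases lt_or_ge t 0 with ht | ht
  · rw [if_pos ht, if_pos (mul_neg_of_pos_of_neg hv ht), abs_mul, abs_of_pos hv,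
      Real.mul_rpow hv.le (abs_nonneg t)]
    ring
  · rw [if_neg ht.not_gt, if_neg (mul_nonneg hv.le ht).not_gt, Real.mul_rpow hv.le ht]
    ring

theorem setIntegral_Iio_mul {v : ℝ} (hv : 0 < v) (g : ℝ → ℝ) (y : ℝ) :
    ∫ u in Iio (v * y), g u = ∫ t in Iio y, v * g (v * t) := by
  have h := Measure.setIntegral_comp_smul_of_pos volume g (Iio y) hv
  rw [LinearOrderedField.smul_Iio hv] at h
  simp only [smul_eq_mul, Module.finrank_self, pow_one] at h
  rw [integral_const_mul, h, mul_inv_cancel_left₀ hv.ne']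

theorem rpow_mul_comp_sq_eq (r : ℝ) (f : ℝ → ℝ) {b v : ℝ} (hb : 0 < b) (hv : 0 < v) :
    v ^ r * f (v ^ 2 * b) = b ^ (-((r - 1) / 2)) / 2 * ((|(2 : ℝ)| * v ^ ((2 : ℝ) - 1)) •
      ((b * v ^ (2 : ℝ)) ^ ((r - 1) / 2) * f (b * v ^ (2 : ℝ)))) := by
  rw [Real.mul_rpow hb.le (by positivity), ← Real.rpow_mul hv.le, Real.rpow_neg hb.le,
    abs_of_pos (two_pos : (0 : ℝ) < 2), smul_eq_mul]
  have hb' := (Real.rpow_pos_of_pos hb ((r - 1) / 2)).ne'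
  have hv' : v ^ r = v ^ ((2 : ℝ) - 1) * v ^ (2 * ((r - 1) / 2)) := by
    rw [← Real.rpow_add hv]
    ring_nf
  rw [hv', Real.rpow_two, mul_comm b]
  field_simp

theorem integrableOn_rpow_mul_comp_sq {r : ℝ} {f : ℝ → ℝ} {b : ℝ} (hb : 0 < b)
    (hf : IntegrableOn (fun x => x ^ ((r - 1) / 2) * f x) (Ioi 0)) :
    IntegrableOn (fun v => v ^ r * f (v ^ 2 * b)) (Ioi 0) := by
  refine IntegrableOn.congr_fun ?_ (fun v hv => (rpow_mul_comp_sq_eq r f hb hv).symm)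
    measurableSet_Ioi
  refine Integrable.const_mul ?_ _
  refine (integrableOn_Ioi_comp_rpow_iff
    (fun x => (b * x) ^ ((r - 1) / 2) * f (b * x)) two_ne_zero).2 ?_
  refine (integrableOn_Ioi_comp_mul_left_iff (fun x => x ^ ((r - 1) / 2) * f x) 0 hb).2 ?_
  rwa [mul_zero]

theorem integral_rpow_mul_comp_sq (r : ℝ) (f : ℝ → ℝ) {b : ℝ} (hb : 0 < b) :
    ∫ v in Ioi (0 : ℝ), v ^ r * f (v ^ 2 * b) =
      1 / 2 * (∫ x in Ioi (0 : ℝ), x ^ ((r - 1) / 2) * f x) * b ^ (-((r + 1) / 2)) := by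
  rw [setIntegral_congr_fun measurableSet_Ioi fun v hv => rpow_mul_comp_sq_eq r f hb hv,
    integral_const_mul,
    integral_comp_rpow_Ioi (fun x => (b * x) ^ ((r - 1) / 2) * f (b * x)) two_ne_zero,
    integral_comp_mul_left_Ioi (fun x => x ^ ((r - 1) / 2) * f x) 0 hb, mul_zero, smul_eq_mul]
  have hb' : b ^ (-((r + 1) / 2)) = b ^ (-((r - 1) / 2)) * b⁻¹ := by
    rw [← Real.rpow_neg_one b, ← Real.rpow_add hb]
    ring_nf
  rw [hb']
  ring

/-- The Bayes objective factors into a constant depending only on `f` and an integral that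
does not involve `f`. -/
theorem integral_rhoAsym_factorization
    {p c₁ c₂ q y : ℝ} (hc₁ : 0 ≤ c₁) (hc₂ : 0 ≤ c₂)
    {f : ℝ → ℝ} (hf_meas : Measurable f) (hf_nonneg : ∀ t > (0 : ℝ), 0 ≤ f t)
    (hf_int : IntegrableOn (fun x => x ^ ((q + p - 1) / 2) * f x) (Ioi 0)) (h : ℝ)
    (h_fin : IntegrableOn
      (fun t => rhoAsym p c₁ c₂ (t + h) * (1 + t ^ 2) ^ (-((q + p + 1) / 2))) (Iio y)) :
    (∫ v in Ioi (0 : ℝ), ∫ u in Iio (v * y),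
        rhoAsym p c₁ c₂ (u + h * v) * (v ^ (q - 1) * f (u ^ 2 + v ^ 2))) =
      1 / 2 * (∫ x in Ioi (0 : ℝ), x ^ ((q + p - 1) / 2) * f x) *
        ∫ t in Iio y, rhoAsym p c₁ c₂ (t + h) * (1 + t ^ 2) ^ (-((q + p + 1) / 2)) := by
  have hpos (t : ℝ) : 0 < 1 + t ^ 2 := by positivity
  set C := 1 / 2 * ∫ x in Ioi (0 : ℝ), x ^ ((q + p - 1) / 2) * f x
  let F : ℝ → ℝ → ℝ := fun v t =>
    rhoAsym p c₁ c₂ (t + h) * (v ^ (q + p) * f (v ^ 2 * (1 + t ^ 2)))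
  have hF_nonneg (t : ℝ) {v : ℝ} (hv : 0 < v) : 0 ≤ F v t :=
    mul_nonneg (rhoAsym_nonneg hc₁ hc₂ _) (mul_nonneg (Real.rpow_nonneg hv.le _)
      (hf_nonneg _ (mul_pos (pow_pos hv 2) (hpos t))))
  have hF_integral (t : ℝ) : ∫ v in Ioi (0 : ℝ), F v t =
      C * (rhoAsym p c₁ c₂ (t + h) * (1 + t ^ 2) ^ (-((q + p + 1) / 2))) := by
    rw [integral_const_mul, integral_rpow_mul_comp_sq _ _ (hpos t)]
    ring
  have hF_meas : Measurable (Function.uncurry F) := by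
    have hρ := measurable_rhoAsym p c₁ c₂
    simp only [F, Function.uncurry_def]
    fun_prop
  have hF_int : Integrable (Function.uncurry F)
      ((volume.restrict (Ioi 0)).prod (volume.restrict (Iio y))) := by
    refine (integrable_prod_iff' hF_meas.aestronglyMeasurable).2 ⟨?_, ?_⟩
    · exact .of_forall fun t => (integrableOn_rpow_mul_comp_sq (hpos t) hf_int).const_mul
        (rhoAsym p c₁ c₂ (t + h))
    · refine (h_fin.const_mul C).congr (.of_forall fun t => ?_)
      simp only [← hF_integral t]
      exact setIntegral_congr_fun measurableSet_Ioi fun v hv =>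
        (Real.norm_of_nonneg (hF_nonneg t hv)).symm
  have hF_inner {v : ℝ} (hv : 0 < v) :
      ∫ u in Iio (v * y), rhoAsym p c₁ c₂ (u + h * v) * (v ^ (q - 1) * f (u ^ 2 + v ^ 2)) =
        ∫ t in Iio y, F v t := by
    rw [setIntegral_Iio_mul hv]
    congr 1 with t
    have hv' : v ^ (q + p) = v * v ^ p * v ^ (q - 1) := by
      rw [Real.rpow_add hv, Real.rpow_sub_one hv.ne']
      field_simp
    rw [show v * t + h * v = v * (t + h) by ring, rhoAsym_mul p c₁ c₂ hv,
      show (v * t) ^ 2 + v ^ 2 = v ^ 2 * (1 + t ^ 2) by ring]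
    simp only [F, hv']
    ring
  rw [setIntegral_congr_fun measurableSet_Ioi fun v hv => hF_inner hv,
    integral_integral_swap hF_int]
  simp only [hF_integral, integral_const_mul]

/-- Lemma 3 (robustness of the generalized Bayes estimator): under the asymmetric `L^p`
loss, `h*` minimizes the Bayes objective
`h ↦ ∫₀^∞∫_{-∞}^{vy} ρ_{c₁,c₂}(u+hv) v^{q-1} f(u²+v²) du dv`
iff `h*` minimizes `h ↦ ∫_{-∞}^{y} ρ_{c₁,c₂}(t+h)(1+t²)^{-(q+p+1)/2} dt`; in particular
the set of minimizers does not depend on the model density `f`. -/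
theorem stmt7
    (p c₁ c₂ : ℝ) (hp : 0 < p) (hc₁ : 0 < c₁) (hc₂ : 0 < c₂)
    (q : ℝ) (y : ℝ)
    (f : ℝ → ℝ) (hf_meas : Measurable f) (hf_nonneg : ∀ t > (0 : ℝ), 0 ≤ f t)
    (hf_int : IntegrableOn (fun x => x ^ ((q + p - 1) / 2) * f x) (Ioi 0))
    (hf_pos : 0 < ∫ x in Ioi (0 : ℝ), x ^ ((q + p - 1) / 2) * f x)
    (h_fin : ∀ h : ℝ, IntegrableOn
      (fun t => rhoAsym p c₁ c₂ (t + h) * (1 + t ^ 2) ^ (-((q + p + 1) / 2))) (Iio y)) :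
    ∀ hstar : ℝ,
      ((∀ h : ℝ,
          (∫ v in Ioi (0 : ℝ), ∫ u in Iio (v * y),
              rhoAsym p c₁ c₂ (u + hstar * v) * (v ^ (q - 1) * f (u ^ 2 + v ^ 2))) ≤
            ∫ v in Ioi (0 : ℝ), ∫ u in Iio (v * y),
              rhoAsym p c₁ c₂ (u + h * v) * (v ^ (q - 1) * f (u ^ 2 + v ^ 2))) ↔
        (∀ h : ℝ,
          (∫ t in Iio y,
              rhoAsym p c₁ c₂ (t + hstar) * (1 + t ^ 2) ^ (-((q + p + 1) / 2))) ≤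
            ∫ t in Iio y,
              rhoAsym p c₁ c₂ (t + h) * (1 + t ^ 2) ^ (-((q + p + 1) / 2)))) := by
  have hC : 0 < 1 / 2 * ∫ x in Ioi (0 : ℝ), x ^ ((q + p - 1) / 2) * f x := by positivity
  intro hstar
  refine forall_congr' fun h => ?_
  rw [integral_rhoAsym_factorization hc₁.le hc₂.le hf_meas hf_nonneg hf_int _ (h_fin hstar),
    integral_rhoAsym_factorization hc₁.le hc₂.le hf_meas hf_nonneg hf_int _ (h_fin h)]
  exact mul_le_mul_iff_right₀ hC
end
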